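/- arXiv:2406.17395 — 2 statements merged into one kernel-verified Lean document; each statement's English description precedes it below -/
import Mathlib

section
/- Let θ1 ≥ 1 and θ2 ≤ −2 be integers. Let v, b, k, r, λ be positive integers and x, y integers with x ≠ y. Let M be a v×b {0,1}-matrix with all row sums r and all column sums k satisfying M·Mᵀ = (r−λ)·I + λ·J, and let X be a symmetric b×b {0,1}-matrix with zero diagonal satisfying Mᵀ·M = k·I + x·X + y·(J − I − X). Assume the graph with adjacency matrix X is connected and its set of eigenvalues is exactly {e0, e1, e2} with e0 > e1 > e2. Assume x = k + (θ1+1)(θ2+1) − (e1+1)(e2+1), y = k + θ1·θ2 − e1·e2, λ = r + θ1·θ2, (r − λ + y − k)/(x − y) = θ1 + θ2, and (λ·k − y·r)/(x − y) = √(λ·(k + e0 + θ1·θ2)). Then the graph on v+b vertices with block adjacency matrix [[O, M],[Mᵀ, X]] is connected and its set of adjacency eigenvalues is exactly {e0 − θ2, θ1, θ2} (with e0 − θ2 > θ1 > θ2). Furthermore, if r ≠ k + e0 then this graph has coherent rank 9. -/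
open Matrix

/-- `θ` is an eigenvalue of the (real) adjacency matrix of `G`. -/
def adjEig {V : Type} [Fintype V] [DecidableEq V] (G : SimpleGraph V) [DecidableRel G.Adj]
    (θ : ℝ) : Prop :=
  ∃ f : V → ℝ, f ≠ 0 ∧ (SimpleGraph.adjMatrix ℝ G).mulVec f = θ • f

/-- `Γ ∈ 𝒢₃(θ0,θ1,θ2)`: `Γ` is connected and the set of eigenvalues of its adjacency
matrix is exactly `{θ0, θ1, θ2}`, where `θ0 > θ1 > θ2`. -/
def InG3 {V : Type} [Fintype V] [DecidableEq V] (G : SimpleGraph V) [DecidableRel G.Adj]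
    (θ0 θ1 θ2 : ℝ) : Prop :=
  G.Connected ∧ θ1 < θ0 ∧ θ2 < θ1 ∧ {θ : ℝ | adjEig G θ} = {θ0, θ1, θ2}

/-- A coherent configuration of rank `r` on the finite set `V`, given as a family of
`{0,1}`-matrices `A 1, …, A r`. -/
def IsCoherentConfig {V : Type} [Fintype V] [DecidableEq V] {r : ℕ}
    (A : Fin r → Matrix V V ℝ) : Prop :=
  (∀ i x y, A i x y = 0 ∨ A i x y = 1) ∧
  (∑ i, A i) = Matrix.of (fun _ _ => (1 : ℝ)) ∧
  (∀ i, ∃ j, (A i)ᵀ = A j) ∧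
  (∃ Δ : Finset (Fin r), ∑ i ∈ Δ, A i = 1) ∧
  (∀ i j, A i * A j ∈ Submodule.span ℝ (Set.range A))

/-- The coherent rank of `G` is `n`: `n` is the least rank of a coherent configuration on
the vertex set of `G` whose real linear span contains the adjacency matrix of `G`. -/
def HasCoherentRank {V : Type} [Fintype V] [DecidableEq V] (G : SimpleGraph V)
    [DecidableRel G.Adj] (n : ℕ) : Prop :=
  IsLeast {r : ℕ | ∃ A : Fin r → Matrix V V ℝ,
    IsCoherentConfig A ∧ SimpleGraph.adjMatrix ℝ G ∈ Submodule.span ℝ (Set.range A)} n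

local notation "𝟙" => Matrix.of (fun _ _ => (1 : ℝ))

theorem Matrix.allOnes_mul_allOnes (m n o : Type) [Fintype n] :
    (𝟙 : Matrix m n ℝ) * (𝟙 : Matrix n o ℝ) = (Fintype.card n : ℝ) • (𝟙 : Matrix m o ℝ) := by
  ext i j
  simp [Matrix.mul_apply]

theorem Matrix.mul_allOnes {m n o : Type} [Fintype n] {N : Matrix m n ℝ} {c : ℝ}
    (h : ∀ i, ∑ j, N i j = c) : N * (𝟙 : Matrix n o ℝ) = c • (𝟙 : Matrix m o ℝ) := by
  ext i j
  simp [Matrix.mul_apply, h]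

theorem Matrix.allOnes_mul {m n o : Type} [Fintype n] {N : Matrix n o ℝ} {c : ℝ}
    (h : ∀ j, ∑ i, N i j = c) : (𝟙 : Matrix m n ℝ) * N = c • (𝟙 : Matrix m o ℝ) := by
  ext i j
  simp [Matrix.mul_apply, h]

/-- A real symmetric matrix is annihilated by the product over its eigenvalues. -/
theorem Matrix.cubic_eq_zero_of_eigenvalues {n : Type} [Fintype n] [DecidableEq n]
    {X : Matrix n n ℝ} (hX : Xᵀ = X) {e0 e1 e2 : ℝ}
    (h : ∀ (θ : ℝ) (f : n → ℝ), f ≠ 0 → X *ᵥ f = θ • f → θ = e0 ∨ θ = e1 ∨ θ = e2) :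
    (X - e0 • 1) * ((X - e1 • 1) * (X - e2 • 1)) = 0 := by
  have hH : X.IsHermitian := by
    rw [Matrix.IsHermitian, Matrix.conjTranspose_eq_transpose_of_trivial, hX]
  have key : ∀ (θ : ℝ) (f : n → ℝ), X *ᵥ f = θ • f → ∀ e : ℝ,
      (X - e • (1 : Matrix n n ℝ)) *ᵥ f = (θ - e) • f := by
    intro θ f hf e
    rw [Matrix.sub_mulVec, hf, Matrix.smul_mulVec, Matrix.one_mulVec, sub_smul]
  have hlin : Matrix.mulVecLin ((X - e0 • 1) * ((X - e1 • 1) * (X - e2 • 1))) = 0 := by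
    refine (hH.eigenvectorBasis.toBasis.map (WithLp.linearEquiv 2 ℝ (n → ℝ))).ext fun j => ?_
    have hj := hH.mulVec_eigenvectorBasis j
    have hne : (hH.eigenvectorBasis j).ofLp ≠ 0 := fun h0 =>
      hH.eigenvectorBasis.orthonormal.ne_zero j (by ext i; exact congrFun h0 i)
    have hθ := h _ _ hne hj
    simp only [Module.Basis.map_apply, OrthonormalBasis.coe_toBasis, WithLp.linearEquiv_apply,
      Matrix.mulVecLin_apply, LinearMap.zero_apply]
    change _ *ᵥ (hH.eigenvectorBasis j).ofLp = 0
    rw [← Matrix.mulVec_mulVec, ← Matrix.mulVec_mulVec, key _ _ hj, Matrix.mulVec_smul,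
      key _ _ hj, Matrix.mulVec_smul, Matrix.mulVec_smul, key _ _ hj, smul_smul, smul_smul]
    have : (hH.eigenvalues j - e2) * (hH.eigenvalues j - e1) * (hH.eigenvalues j - e0) = 0 := by
      rcases hθ with h | h | h <;> rw [h] <;> ring
    rw [this, zero_smul]
  exact Matrix.ext_of_mulVec_single fun i => by
    rw [Matrix.zero_mulVec]
    exact congrArg (fun L => L (Pi.single i 1)) hlin

/-- In a connected regular graph, eigenvectors for the degree are constant. -/
theorem SimpleGraph.Connected.eq_of_adjMatrix_mulVec {V : Type} [Fintype V] [DecidableEq V]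
    {H : SimpleGraph V} [DecidableRel H.Adj] (hH : H.Connected) {d : ℝ}
    (hd : ∀ i, (H.degree i : ℝ) = d) {u : V → ℝ} (hu : H.adjMatrix ℝ *ᵥ u = d • u) (i j : V) :
    u i = u j := by
  refine (H.lapMatrix_mulVec_eq_zero_iff_forall_reachable (x := u)).1 ?_ i j
    (hH.preconnected i j)
  ext k
  have := congrFun hu k
  rw [SimpleGraph.adjMatrix_mulVec_apply] at this
  rw [SimpleGraph.lapMatrix_mulVec_apply, this, hd]
  simp

/-- The eigenvalues of a regular graph are at most its degree. -/
theorem adjEig_le_degree {V : Type} [Fintype V] [DecidableEq V]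
    {H : SimpleGraph V} [DecidableRel H.Adj] {d : ℝ}
    (hd : ∀ i, (H.degree i : ℝ) = d) {θ : ℝ} (hθ : adjEig H θ) : θ ≤ d := by
  obtain ⟨f, hf0, hf⟩ := hθ
  have hev : Module.End.HasEigenvalue (Matrix.toLin' (H.adjMatrix ℝ)) θ :=
    Module.End.hasEigenvalue_of_hasEigenvector
      ⟨Module.End.mem_eigenspace_iff.2 (by simpa using hf), hf0⟩
  obtain ⟨k, hk⟩ := eigenvalue_mem_ball hev
  rw [Metric.mem_closedBall, Real.dist_eq] at hk
  have h1 : ∑ j ∈ Finset.univ.erase k, ‖H.adjMatrix ℝ k j‖ ≤ d := by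
    calc _ ≤ ∑ j, ‖H.adjMatrix ℝ k j‖ :=
          Finset.sum_le_sum_of_subset_of_nonneg (Finset.subset_univ _) (fun _ _ _ => norm_nonneg _)
      _ = d := by
          rw [← hd k, ← SimpleGraph.card_neighborFinset_eq_degree,
            SimpleGraph.neighborFinset_eq_filter]
          simp [SimpleGraph.adjMatrix_apply, apply_ite]
  have h2 := le_abs_self (θ - H.adjMatrix ℝ k k)
  have h3 : H.adjMatrix ℝ k k = 0 := by simp
  linarith

/-- The largest eigenvalue of a regular graph is its degree. -/
theorem degree_eq_of_adjEig {V : Type} [Fintype V] [DecidableEq V] [Nonempty V]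
    {H : SimpleGraph V} [DecidableRel H.Adj] {d e0 e1 e2 : ℝ}
    (hd : ∀ i, (H.degree i : ℝ) = d) (h01 : e1 < e0) (h12 : e2 < e1)
    (heig : {θ : ℝ | adjEig H θ} = {e0, e1, e2}) : d = e0 := by
  have hle : e0 ≤ d := adjEig_le_degree hd (by
    change e0 ∈ {θ : ℝ | adjEig H θ}
    simp [heig])
  have hmem : d ∈ {θ : ℝ | adjEig H θ} := by
    refine ⟨fun _ => 1, fun h => ?_, ?_⟩
    · exact one_ne_zero (congrFun h (Classical.arbitrary V))
    · ext i
      simp [SimpleGraph.adjMatrix_mulVec_apply, hd]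
  rw [heig] at hmem
  rcases hmem with h | h | h
  · exact h
  · linarith
  · rw [Set.mem_singleton_iff] at h; linarith

/-- A connected regular graph with three eigenvalues is strongly regular. -/
theorem adjMatrix_sq_of_three_eigenvalues {V : Type} [Fintype V] [DecidableEq V]
    {H : SimpleGraph V} [DecidableRel H.Adj] (hH : H.Connected) {e0 e1 e2 : ℝ}
    (hd : ∀ i, (H.degree i : ℝ) = e0)
    (heig : {θ : ℝ | adjEig H θ} = {e0, e1, e2}) :
    H.adjMatrix ℝ * H.adjMatrix ℝ =
      (e1 + e2) • H.adjMatrix ℝ - (e1 * e2) • (1 : Matrix V V ℝ) + (e0 + e1 * e2) • 𝟙 := by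
  set X := H.adjMatrix ℝ with hX
  have hXt : Xᵀ = X := SimpleGraph.transpose_adjMatrix _
  set B := (X - e1 • 1) * (X - e2 • 1) with hB
  have hBexp : B = X * X - (e1 + e2) • X + (e1 * e2) • (1 : Matrix V V ℝ) := by
    rw [hB]
    simp only [mul_sub, sub_mul, smul_mul_assoc, mul_smul_comm, mul_one, one_mul]
    module
  have hB0 : (X - e0 • 1) * B = 0 := by
    refine Matrix.cubic_eq_zero_of_eigenvalues hXt fun θ f hf hθ => ?_
    have : θ ∈ {θ : ℝ | adjEig H θ} := ⟨f, hf, hθ⟩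
    simpa [heig] using this
  have hBt : ∀ i j, B i j = B j i := by
    intro i j
    have : Bᵀ = B := by
      rw [hBexp]
      simp [Matrix.transpose_add, Matrix.transpose_sub, Matrix.transpose_mul, hXt]
    exact (congrFun (congrFun this j) i)
  have hcol : ∀ i i' j, B i j = B i' j := by
    intro i i' j
    refine hH.eq_of_adjMatrix_mulVec hd (u := fun i => B i j) ?_ i i'
    have h := sub_eq_zero.1 (by rw [← sub_mul]; exact hB0 : X * B - (e0 • 1) * B = 0)
    ext l
    have h' := congrFun (congrFun h l) j
    rw [smul_mul_assoc, one_mul] at h'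
    exact h'
  have hdiag : ∀ i, B i i = e0 + e1 * e2 := by
    intro i
    have hsq : (X * X) i i = e0 := by
      rw [hX, SimpleGraph.adjMatrix_mul_self_apply_self, hd]
    have hX0 : X i i = 0 := by simp [hX]
    simp only [hBexp, Matrix.add_apply, Matrix.sub_apply, Matrix.smul_apply, hsq, hX0,
      Matrix.one_apply_eq]
    simp
  have hBJ : B = (e0 + e1 * e2) • 𝟙 := by
    ext i j
    rw [hBt, hcol j i i, hdiag]
    simp
  rw [← hBJ, hBexp]
  abel

theorem Matrix.smul_eq_of_sq_eq_add_vecMulVec {V : Type} [Fintype V] [DecidableEq V]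
    {A : Matrix V V ℝ} {θ1 θ2 : ℝ} {w : V → ℝ}
    (hA : A * A = (θ1 + θ2) • A - (θ1 * θ2) • (1 : Matrix V V ℝ) + Matrix.vecMulVec w w)
    {θ : ℝ} {f : V → ℝ} (hf : A *ᵥ f = θ • f) :
    ((θ - θ1) * (θ - θ2)) • f = (w ⬝ᵥ f) • w := by
  have h := congrArg (· *ᵥ f) hA
  simp only [← Matrix.mulVec_mulVec, Matrix.add_mulVec, Matrix.sub_mulVec, Matrix.smul_mulVec,
    Matrix.one_mulVec, hf, Matrix.mulVec_smul, Matrix.vecMulVec_mulVec, op_smul_eq_smul] at h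
  have h' : (w ⬝ᵥ f) • w = θ • θ • f - ((θ1 + θ2) • θ • f - (θ1 * θ2) • f) := by
    rw [h]; abel
  rw [h']
  module

/-- If a quadratic polynomial in the adjacency matrix is a positive rank-one matrix, then the
graph has diameter at most two. -/
theorem SimpleGraph.connected_of_adjMatrix_sq {V : Type} [Fintype V] [DecidableEq V] [Nonempty V]
    {G : SimpleGraph V} [DecidableRel G.Adj] {a c : ℝ} {w : V → ℝ} (hw : ∀ i, 0 < w i)
    (hA : G.adjMatrix ℝ * G.adjMatrix ℝ =
      a • G.adjMatrix ℝ - c • (1 : Matrix V V ℝ) + Matrix.vecMulVec w w) :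
    G.Connected := by
  refine SimpleGraph.Connected.mk fun i j => ?_
  by_cases hij : i = j
  · exact hij ▸ SimpleGraph.Reachable.refl _
  by_cases hadj : G.Adj i j
  · exact hadj.reachable
  have h := congrFun (congrFun hA i) j
  have hne : (G.adjMatrix ℝ * G.adjMatrix ℝ) i j ≠ 0 := by
    rw [h]
    simpa [hij, hadj, Matrix.vecMulVec_apply] using ⟨(hw i).ne', (hw j).ne'⟩
  rw [Matrix.mul_apply] at hne
  obtain ⟨z, -, hz⟩ := Finset.exists_ne_zero_of_sum_ne_zero hne
  simp only [SimpleGraph.adjMatrix_apply, mul_ite, mul_one, mul_zero, ne_eq, ite_eq_right_iff,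
    one_ne_zero, imp_false, not_not, Classical.not_imp] at hz
  exact hz.2.reachable.trans hz.1.reachable

section Blocks

variable {m n : Type} [Fintype m] [Fintype n] {M : Matrix m n ℝ} {X : Matrix n n ℝ}

theorem fromBlocks_mulVec_const {r k d z : ℝ} (hrow : ∀ i, ∑ j, M i j = r)
    (hcol : ∀ j, ∑ i, M i j = k) (hX : ∀ i, ∑ j, X i j = d) (hz : z * z = d * z + r * k) :
    Matrix.fromBlocks 0 M Mᵀ X *ᵥ Sum.elim (fun _ => r) (fun _ => z) =
      z • Sum.elim (fun _ => r) (fun _ => z) := by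
  rw [Matrix.fromBlocks_mulVec]
  ext (i | i)
  · simp [Matrix.mulVec, dotProduct, ← Finset.sum_mul, hrow, mul_comm z]
  · simp [Matrix.mulVec, dotProduct, ← Finset.sum_mul, hcol, hX, hz]
    ring

theorem fromBlocks_mulVec_lift {θ1 θ2 α : ℝ} {u : n → ℝ}
    (hX : X *ᵥ u = (θ1 + θ2) • u) (hM : Mᵀ *ᵥ (M *ᵥ u) = (-(θ1 * θ2)) • u)
    (hα : (α - θ1) * (α - θ2) = 0) :
    Matrix.fromBlocks 0 M Mᵀ X *ᵥ Sum.elim (M *ᵥ u) (α • u) =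
      α • Sum.elim (M *ᵥ u) (α • u) := by
  rw [Matrix.fromBlocks_mulVec]
  have h : Mᵀ *ᵥ (M *ᵥ u) + X *ᵥ (α • u) = α • α • u := by
    rw [hM, Matrix.mulVec_smul, hX, smul_smul, smul_smul, ← add_smul]
    congr 1
    linarith
  ext (i | i)
  · simp [Matrix.mulVec_smul]
  · simpa using congrFun h i

/-- The negative eigenvalue of the quotient matrix `[[0, r], [k, d]]` has to be `θ2`, as its
eigenvector is not proportional to the positive vector `w`. -/
theorem sq_eq_of_fromBlocks_sq [DecidableEq m] [DecidableEq n] [Nonempty m] [Nonempty n]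
    {r k d θ1 θ2 α β : ℝ} (hr : 0 < r) (hk : 0 < k) (hθ1 : 0 < θ1) (hα : 0 < α) (hβ : 0 < β)
    (hrow : ∀ i, ∑ j, M i j = r) (hcol : ∀ j, ∑ i, M i j = k) (hX : ∀ i, ∑ j, X i j = d)
    (hA : Matrix.fromBlocks 0 M Mᵀ X * Matrix.fromBlocks 0 M Mᵀ X =
      (θ1 + θ2) • Matrix.fromBlocks 0 M Mᵀ X - (θ1 * θ2) • (1 : Matrix (m ⊕ n) (m ⊕ n) ℝ) +
        Matrix.vecMulVec (Sum.elim (fun _ => α) (fun _ => β))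
          (Sum.elim (fun _ => α) (fun _ => β))) :
    θ2 * θ2 = d * θ2 + r * k := by
  have hrk : 0 < r * k := mul_pos hr hk
  obtain ⟨z, hz, hz0⟩ : ∃ z : ℝ, z * z = d * z + r * k ∧ z < 0 := by
    have hD : 0 ≤ d ^ 2 + 4 * (r * k) := by positivity
    refine ⟨(d - √(d ^ 2 + 4 * (r * k))) / 2, ?_, ?_⟩
    · nlinarith [Real.mul_self_sqrt hD]
    · have := Real.lt_sqrt_of_sq_lt (show d ^ 2 < d ^ 2 + 4 * (r * k) by linarith)
      linarith
  have h := Matrix.smul_eq_of_sq_eq_add_vecMulVec hA (fromBlocks_mulVec_const hrow hcol hX hz)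
  set c := (Sum.elim (fun _ : m => α) (fun _ : n => β)) ⬝ᵥ (Sum.elim (fun _ => r) (fun _ => z))
  have h1 : (z - θ1) * (z - θ2) * r = c * α := by
    simpa using congrFun h (Sum.inl (Classical.arbitrary m))
  have h2 : (z - θ1) * (z - θ2) * z = c * β := by
    simpa using congrFun h (Sum.inr (Classical.arbitrary n))
  have h0 : (z - θ1) * (z - θ2) = 0 := by
    by_contra hne
    have h3 : ((z - θ1) * (z - θ2)) ^ 2 * (r * z) = c ^ 2 * (α * β) := by
      linear_combination h1 * ((z - θ1) * (z - θ2) * z) + c * α * h2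
    have h4 : r * z < 0 := mul_neg_of_pos_of_neg hr hz0
    have h5 : 0 < ((z - θ1) * (z - θ2)) ^ 2 := by positivity
    have h6 : 0 ≤ c ^ 2 * (α * β) := by positivity
    nlinarith
  have hz2 : z = θ2 := by
    rcases mul_eq_zero.1 h0 with h | h <;> linarith
  rwa [hz2] at hz

theorem eigenvalues_fromBlocks [DecidableEq m] [DecidableEq n] [Nonempty m] [Nonempty n]
    {r k d θ1 θ2 α β : ℝ} (hr : 0 < r) (hk : 0 < k) (hθ1 : 0 < θ1) (hθ2 : θ2 < 0)
    (hd : 0 ≤ d) (hα : 0 < α) (hβ : 0 < β)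
    (hrow : ∀ i, ∑ j, M i j = r) (hcol : ∀ j, ∑ i, M i j = k) (hX : ∀ i, ∑ j, X i j = d)
    (hA : Matrix.fromBlocks 0 M Mᵀ X * Matrix.fromBlocks 0 M Mᵀ X =
      (θ1 + θ2) • Matrix.fromBlocks 0 M Mᵀ X - (θ1 * θ2) • (1 : Matrix (m ⊕ n) (m ⊕ n) ℝ) +
        Matrix.vecMulVec (Sum.elim (fun _ => α) (fun _ => β))
          (Sum.elim (fun _ => α) (fun _ => β)))
    {u : n → ℝ} (hu0 : u ≠ 0) (hXu : X *ᵥ u = (θ1 + θ2) • u)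
    (hMu : Mᵀ *ᵥ (M *ᵥ u) = (-(θ1 * θ2)) • u) :
    {θ : ℝ | ∃ f, f ≠ 0 ∧ Matrix.fromBlocks 0 M Mᵀ X *ᵥ f = θ • f} = {d - θ2, θ1, θ2} ∧
      θ1 < d - θ2 := by
  have hquad := sq_eq_of_fromBlocks_sq hr hk hθ1 hα hβ hrow hcol hX hA
  have hf := fromBlocks_mulVec_const hrow hcol hX
    (z := d - θ2) (by linear_combination hquad)
  have hw := Matrix.smul_eq_of_sq_eq_add_vecMulVec hA hf
  set w := Sum.elim (fun _ : m => α) (fun _ : n => β) with hw_def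
  have hc : 0 < w ⬝ᵥ Sum.elim (fun _ : m => r) (fun _ : n => d - θ2) := by
    have : 0 < d - θ2 := by linarith
    simp [hw_def, dotProduct]
    positivity
  set c := w ⬝ᵥ Sum.elim (fun _ : m => r) (fun _ : n => d - θ2)
  have h1 : (d - θ2 - θ1) * (d - θ2 - θ2) * r = c * α := by
    simpa [hw_def] using congrFun hw (Sum.inl (Classical.arbitrary m))
  have hlift : ∀ e : ℝ, e ≠ 0 → (e - θ1) * (e - θ2) = 0 →
      ∃ f, f ≠ 0 ∧ Matrix.fromBlocks 0 M Mᵀ X *ᵥ f = e • f := by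
    intro e he he'
    refine ⟨_, fun h0 => hu0 ?_, fromBlocks_mulVec_lift hXu hMu he'⟩
    ext i
    have := congrFun h0 (Sum.inr i)
    simpa [he] using this
  constructor
  · ext θ
    simp only [Set.mem_ofPred_eq, Set.mem_insert_iff, Set.mem_singleton_iff]
    constructor
    · rintro ⟨f, hf0, hfθ⟩
      have hθ := Matrix.smul_eq_of_sq_eq_add_vecMulVec hA hfθ
      by_cases hq : (θ - θ1) * (θ - θ2) = 0
      · rcases mul_eq_zero.1 hq with h | h
        · exact Or.inr (Or.inl (by linarith))
        · exact Or.inr (Or.inr (by linarith))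
      · left
        have hwA : Matrix.fromBlocks 0 M Mᵀ X *ᵥ w = (d - θ2) • w := by
          have h := congrArg (Matrix.fromBlocks 0 M Mᵀ X *ᵥ ·) hw
          simp only [Matrix.mulVec_smul, hf] at h
          rw [smul_comm, hw, smul_comm] at h
          exact ((smul_right_injective _ hc.ne') h).symm
        have h := congrArg (Matrix.fromBlocks 0 M Mᵀ X *ᵥ ·) hθ
        simp only [Matrix.mulVec_smul, hfθ, hwA] at h
        rw [smul_comm _ (d - θ2), ← hθ, smul_comm _ θ, ← sub_eq_zero, ← sub_smul,
          smul_eq_zero, smul_eq_zero] at h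
        rcases h with h | h | h
        · linarith
        · exact absurd h hq
        · exact absurd h hf0
    · rintro (h | h | h)
      · refine ⟨_, fun h0 => hr.ne' ?_, h ▸ hf⟩
        simpa using congrFun h0 (Sum.inl (Classical.arbitrary m))
      · exact hlift θ (by rw [h]; exact hθ1.ne') (by rw [h]; ring)
      · exact hlift θ (by rw [h]; exact hθ2.ne) (by rw [h]; ring)
  · have h2 : 0 < (d - θ2 - θ1) * (d - θ2 - θ2) := by
      have := mul_pos hc hα
      rw [← h1] at this
      exact pos_of_mul_pos_left this hr.le
    have h3 := pos_of_mul_pos_left h2 (by linarith)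
    linarith

end Blocks

section CoherentConfig

/-- Matrices in the span of a coherent configuration are functions of the colour. -/
theorem apply_eq_of_mem_span {V : Type} {r : ℕ} {A : Fin r → Matrix V V ℝ}
    {c : V → V → Fin r}
    (hc : ∀ i x y, A i x y = if c x y = i then 1 else 0) {N : Matrix V V ℝ}
    (hN : N ∈ Submodule.span ℝ (Set.range A)) {x y x' y' : V} (h : c x y = c x' y') :
    N x y = N x' y' := by
  obtain ⟨a, rfl⟩ := (Submodule.mem_span_range_iff_exists_fun ℝ).1 hN
  simp [Matrix.sum_apply, hc, h]

variable {V : Type} [Fintype V] [DecidableEq V] {r : ℕ} {A : Fin r → Matrix V V ℝ}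

/-- The colour function of a coherent configuration. -/
theorem IsCoherentConfig.exists_color (hA : IsCoherentConfig A) :
    ∃ c : V → V → Fin r, ∀ i x y, A i x y = if c x y = i then 1 else 0 := by
  obtain ⟨h01, hsum, -⟩ := hA
  have key : ∀ x y, ∃ i, ∀ j, A j x y = if i = j then 1 else 0 := by
    intro x y
    have hs : ∑ i, A i x y = 1 := by
      have := congrFun (congrFun hsum x) y
      simpa [Matrix.sum_apply] using this
    obtain ⟨i, -, hi⟩ := Finset.exists_ne_zero_of_sum_ne_zero (hs ▸ one_ne_zero)
    have hi1 : A i x y = 1 := (h01 i x y).resolve_left hi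
    refine ⟨i, fun j => ?_⟩
    split_ifs with hij
    · rw [← hij, hi1]
    · refine (h01 j x y).resolve_right fun hj => ?_
      have h2 : A i x y + A j x y ≤ ∑ l, A l x y := by
        rw [← Finset.sum_pair (f := fun l => A l x y) hij]
        refine Finset.sum_le_sum_of_subset_of_nonneg (Finset.subset_univ _) fun l _ _ => ?_
        rcases h01 l x y with h | h <;> simp [h]
      linarith
  choose c hc using key
  exact ⟨c, fun i x y => hc x y i⟩

theorem IsCoherentConfig.one_mem (hA : IsCoherentConfig A) :
    (1 : Matrix V V ℝ) ∈ Submodule.span ℝ (Set.range A) := by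
  obtain ⟨-, -, -, ⟨Δ, hΔ⟩, -⟩ := hA
  rw [← hΔ]
  exact Submodule.sum_mem _ fun i _ => Submodule.subset_span ⟨i, rfl⟩

theorem IsCoherentConfig.mul_mem (hA : IsCoherentConfig A) {N P : Matrix V V ℝ}
    (hN : N ∈ Submodule.span ℝ (Set.range A)) (hP : P ∈ Submodule.span ℝ (Set.range A)) :
    N * P ∈ Submodule.span ℝ (Set.range A) := by
  obtain ⟨a, rfl⟩ := (Submodule.mem_span_range_iff_exists_fun ℝ).1 hN
  obtain ⟨a', rfl⟩ := (Submodule.mem_span_range_iff_exists_fun ℝ).1 hP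
  rw [Finset.sum_mul_sum]
  refine Submodule.sum_mem _ fun i _ => Submodule.sum_mem _ fun j _ => ?_
  rw [smul_mul_smul_comm]
  exact Submodule.smul_mem _ _ (hA.2.2.2.2 i j)

/-- If the span of a coherent configuration contains a nowhere vanishing matrix `K`, then the
colour of `(x, y)` determines the diagonal entries of `K` at `x` and at `y`. -/
theorem IsCoherentConfig.diag_eq (hA : IsCoherentConfig A) {c : V → V → Fin r}
    (hc : ∀ i x y, A i x y = if c x y = i then 1 else 0) {K : Matrix V V ℝ}
    (hK : K ∈ Submodule.span ℝ (Set.range A)) (hK0 : ∀ x y, K x y ≠ 0) {x y x' y' : V}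
    (h : c x y = c x' y') : K x x = K x' x' ∧ K y y = K y' y' := by
  have hdiag : ∀ z, ∃ a : V → ℝ, A (c z z) = Matrix.diagonal a ∧ a z = 1 ∧
      ∀ z', a z' ≠ 0 → K z z = K z' z' := by
    intro z
    refine ⟨fun z' => A (c z z) z' z', ?_, by simp [hc], fun z' hz' => ?_⟩
    · ext i j
      by_cases hij : i = j
      · simp [hij]
      · rw [Matrix.diagonal_apply_ne _ hij, hc, if_neg]
        intro hcol
        have := apply_eq_of_mem_span hc hA.one_mem hcol
        simp [hij] at this
    · simp only [hc] at hz'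
      exact (apply_eq_of_mem_span hc hK (of_not_not fun hn => hz' (if_neg hn))).symm
  have hmem : ∀ i, A i ∈ Submodule.span ℝ (Set.range A) := fun i =>
    Submodule.subset_span ⟨i, rfl⟩
  constructor
  · obtain ⟨a, ha, ha1, haK⟩ := hdiag x
    have := apply_eq_of_mem_span hc (hA.mul_mem (hmem (c x x)) hK) h
    rw [ha, Matrix.diagonal_mul, Matrix.diagonal_mul, ha1, one_mul] at this
    exact haK x' fun h0 => hK0 x y (by rw [this, h0, zero_mul])
  · obtain ⟨a, ha, ha1, haK⟩ := hdiag y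
    have := apply_eq_of_mem_span hc (hA.mul_mem hK (hmem (c y y))) h
    rw [ha, Matrix.mul_diagonal, Matrix.mul_diagonal, ha1, mul_one] at this
    exact haK y' fun h0 => hK0 x y (by rw [this, h0, mul_zero])

end CoherentConfig

open Classical in
/-- A coherent configuration on `m ⊕ n` that separates `m` from `n` and contains
`[[0, M], [Mᵀ, X]]` has rank at least `9`. -/
theorem IsCoherentConfig.nine_le {m n : Type} [Fintype m] [Fintype n] [DecidableEq m]
    [DecidableEq n] {ρ : ℕ} {A : Fin ρ → Matrix (m ⊕ n) (m ⊕ n) ℝ} (hA : IsCoherentConfig A)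
    {M : Matrix m n ℝ} {X : Matrix n n ℝ}
    (hN : Matrix.fromBlocks 0 M Mᵀ X ∈ Submodule.span ℝ (Set.range A))
    {K : Matrix (m ⊕ n) (m ⊕ n) ℝ} (hK : K ∈ Submodule.span ℝ (Set.range A))
    (hK0 : ∀ x y, K x y ≠ 0)
    (hKdiag : ∀ i j, K (Sum.inl i) (Sum.inl i) ≠ K (Sum.inr j) (Sum.inr j))
    {p p' : m} (hp : p ≠ p') {i0 i1 : m} {j0 j1 : n} (hM0 : M i0 j0 = 0) (hM1 : M i1 j1 = 1)
    {q q' q0 q0' : n} (hX1 : X q q' = 1) (hXq : X q q = 0) (hX0 : X q0 q0' = 0)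
    (hq0 : q0 ≠ q0') : 9 ≤ ρ := by
  obtain ⟨c, hc⟩ := hA.exists_color
  set B := Matrix.fromBlocks 0 M Mᵀ X with hB
  have hleft : ∀ x x' : m ⊕ n, K x x = K x' x' → x.isLeft = x'.isLeft := by
    rintro (i | i) (j | j) h
    · rfl
    · exact absurd h (hKdiag i j)
    · exact absurd h.symm (hKdiag j i)
    · rfl
  let g : (m ⊕ n) × (m ⊕ n) → Bool × Bool × Bool × Bool := fun z =>
    (z.1.isLeft, z.2.isLeft, decide (z.1 = z.2), decide (B z.1 z.2 = 1))
  have hg : ∀ z z' : (m ⊕ n) × (m ⊕ n), c z.1 z.2 = c z'.1 z'.2 → g z = g z' := by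
    rintro ⟨x, y⟩ ⟨x', y'⟩ h
    have h1 := hA.diag_eq hc hK hK0 h
    have h2 := apply_eq_of_mem_span hc hN h
    have h3 : (x = y) ↔ (x' = y') := by
      have := apply_eq_of_mem_span hc hA.one_mem h
      simp only [Matrix.one_apply] at this
      by_cases hxy : x = y <;> by_cases hxy' : x' = y' <;> simp_all
    simp only [g, hleft _ _ h1.1, hleft _ _ h1.2, h2, h3]
  let S : Finset (Bool × Bool × Bool × Bool) :=
    {(true, true, true, false), (true, true, false, false), (true, false, false, false),
      (true, false, false, true), (false, true, false, false), (false, true, false, true),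
      (false, false, true, false), (false, false, false, true), (false, false, false, false)}
  have hS : S ⊆ Finset.univ.image g := by
    have hqq : q ≠ q' := fun h => by rw [← h, hXq] at hX1; exact zero_ne_one hX1
    simp only [S, Finset.insert_subset_iff, Finset.singleton_subset_iff, Finset.mem_image,
      Finset.mem_univ, true_and]
    refine ⟨⟨(.inl p, .inl p), ?_⟩, ⟨(.inl p, .inl p'), ?_⟩, ⟨(.inl i0, .inr j0), ?_⟩,
      ⟨(.inl i1, .inr j1), ?_⟩, ⟨(.inr j0, .inl i0), ?_⟩, ⟨(.inr j1, .inl i1), ?_⟩,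
      ⟨(.inr q, .inr q), ?_⟩, ⟨(.inr q, .inr q'), ?_⟩, ⟨(.inr q0, .inr q0'), ?_⟩⟩ <;>
    simp [g, *]
  have hcard : (Finset.univ.image g).card ≤ ρ := by
    calc (Finset.univ.image g).card
        ≤ (Finset.univ.image fun z : (m ⊕ n) × (m ⊕ n) => c z.1 z.2).card := by
          refine Finset.card_le_card_of_surjOn
            (fun i => if h : ∃ z : (m ⊕ n) × (m ⊕ n), c z.1 z.2 = i then g h.choose
              else (true, true, true, true)) ?_
          intro l hl
          obtain ⟨z, -, rfl⟩ := Finset.mem_image.1 hl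
          refine ⟨c z.1 z.2, by simp, ?_⟩
          have hex : ∃ z' : (m ⊕ n) × (m ⊕ n), c z'.1 z'.2 = c z.1 z.2 := ⟨z, rfl⟩
          simp only [dif_pos hex]
          exact hg _ _ hex.choose_spec
      _ ≤ ρ := by
        simpa using Finset.card_le_univ (Finset.univ.image fun z : (m ⊕ n) × (m ⊕ n) => c z.1 z.2)
  calc 9 = S.card := by decide
    _ ≤ _ := Finset.card_le_card hS
    _ ≤ ρ := hcard

section RankNine

variable {m n : Type} [DecidableEq m] [DecidableEq n]

/-- The general element of the linear span of the blocks `I, J`, `M, J`, `Mᵀ, J`, `I, X, J`. -/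
def blockCombination (M : Matrix m n ℝ) (X : Matrix n n ℝ)
    (c₀ c₁ c₂ c₃ c₄ c₅ c₆ c₇ c₈ : ℝ) : Matrix (m ⊕ n) (m ⊕ n) ℝ :=
  Matrix.fromBlocks (c₀ • 1 + c₁ • 𝟙) (c₂ • M + c₃ • 𝟙) (c₄ • Mᵀ + c₅ • 𝟙)
    (c₆ • 1 + c₇ • X + c₈ • 𝟙)

/-- The nine relations of the configuration attached to `[[0, M], [Mᵀ, X]]`. -/
def blockRelations (M : Matrix m n ℝ) (X : Matrix n n ℝ) : Fin 9 → Matrix (m ⊕ n) (m ⊕ n) ℝ :=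
  ![Matrix.fromBlocks 1 0 0 0, Matrix.fromBlocks (𝟙 - 1) 0 0 0,
    Matrix.fromBlocks 0 M 0 0, Matrix.fromBlocks 0 (𝟙 - M) 0 0,
    Matrix.fromBlocks 0 0 Mᵀ 0, Matrix.fromBlocks 0 0 (𝟙 - Mᵀ) 0,
    Matrix.fromBlocks 0 0 0 1, Matrix.fromBlocks 0 0 0 X, Matrix.fromBlocks 0 0 0 (𝟙 - 1 - X)]

theorem blockCombination_mem_span (M : Matrix m n ℝ) (X : Matrix n n ℝ)
    (c₀ c₁ c₂ c₃ c₄ c₅ c₆ c₇ c₈ : ℝ) :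
    blockCombination M X c₀ c₁ c₂ c₃ c₄ c₅ c₆ c₇ c₈ ∈
      Submodule.span ℝ (Set.range (blockRelations M X)) := by
  refine (Submodule.mem_span_range_iff_exists_fun ℝ).2
    ⟨![c₀ + c₁, c₁, c₂ + c₃, c₃, c₄ + c₅, c₅, c₆ + c₈, c₇ + c₈, c₈], ?_⟩
  simp only [Fin.sum_univ_succ, Fin.sum_univ_zero, blockRelations, blockCombination]
  simp [Matrix.fromBlocks_smul, Matrix.fromBlocks_add, -Matrix.smul_of]
  refine ⟨?_, ?_, ?_, ?_⟩ <;> module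

theorem fromBlocks_mem_span_blockRelations (M : Matrix m n ℝ) (X : Matrix n n ℝ) :
    Matrix.fromBlocks 0 M Mᵀ X ∈ Submodule.span ℝ (Set.range (blockRelations M X)) := by
  simpa [blockCombination] using blockCombination_mem_span M X 0 0 1 0 1 0 0 1 0

theorem exists_blockRelations_eq (M : Matrix m n ℝ) (X : Matrix n n ℝ) (i : Fin 9) :
    ∃ c₀ c₁ c₂ c₃ c₄ c₅ c₆ c₇ c₈ : ℝ,
      blockRelations M X i = blockCombination M X c₀ c₁ c₂ c₃ c₄ c₅ c₆ c₇ c₈ := by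
  fin_cases i
  · exact ⟨1, 0, 0, 0, 0, 0, 0, 0, 0, by simp [blockRelations, blockCombination]⟩
  · exact ⟨-1, 1, 0, 0, 0, 0, 0, 0, 0, by simp [blockRelations, blockCombination]; abel⟩
  · exact ⟨0, 0, 1, 0, 0, 0, 0, 0, 0, by simp [blockRelations, blockCombination]⟩
  · exact ⟨0, 0, -1, 1, 0, 0, 0, 0, 0, by simp [blockRelations, blockCombination]; abel⟩
  · exact ⟨0, 0, 0, 0, 1, 0, 0, 0, 0, by simp [blockRelations, blockCombination]⟩
  · exact ⟨0, 0, 0, 0, -1, 1, 0, 0, 0, by simp [blockRelations, blockCombination]; abel⟩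
  · exact ⟨0, 0, 0, 0, 0, 0, 1, 0, 0, by simp [blockRelations, blockCombination]⟩
  · exact ⟨0, 0, 0, 0, 0, 0, 0, 1, 0, by simp [blockRelations, blockCombination]⟩
  · exact ⟨0, 0, 0, 0, 0, 0, -1, -1, 1, by simp [blockRelations, blockCombination]; abel⟩

variable [Fintype m] [Fintype n] {M : Matrix m n ℝ} {X : Matrix n n ℝ}

theorem blockCombination_mul {r k d a₁ a₂ b₁ b₂ b₃ s₁ s₂ d₁ d₂ d₃ : ℝ}
    (hrow : ∀ i, ∑ j, M i j = r) (hcol : ∀ j, ∑ i, M i j = k) (hX : ∀ i, ∑ j, X i j = d)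
    (hXt : Xᵀ = X) (hMMt : M * Mᵀ = a₁ • (1 : Matrix m m ℝ) + a₂ • 𝟙)
    (hMtM : Mᵀ * M = b₁ • (1 : Matrix n n ℝ) + b₂ • X + b₃ • 𝟙)
    (hXMt : X * Mᵀ = s₁ • Mᵀ + s₂ • 𝟙)
    (hXX : X * X = d₁ • (1 : Matrix n n ℝ) + d₂ • X + d₃ • 𝟙)
    (c₀ c₁ c₂ c₃ c₄ c₅ c₆ c₇ c₈ e₀ e₁ e₂ e₃ e₄ e₅ e₆ e₇ e₈ : ℝ) :
    blockCombination M X c₀ c₁ c₂ c₃ c₄ c₅ c₆ c₇ c₈ *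
        blockCombination M X e₀ e₁ e₂ e₃ e₄ e₅ e₆ e₇ e₈ =
      blockCombination M X
        (c₀ * e₀ + c₂ * e₄ * a₁)
        (c₀ * e₁ + c₁ * e₀ + Fintype.card m * (c₁ * e₁) + c₂ * e₄ * a₂ + c₂ * e₅ * r +
          c₃ * e₄ * r + c₃ * e₅ * Fintype.card n)
        (c₀ * e₂ + c₂ * e₆ + c₂ * e₇ * s₁)
        (c₀ * e₃ + c₁ * e₂ * k + c₁ * e₃ * Fintype.card m + c₂ * e₇ * s₂ + c₂ * e₈ * r +
          c₃ * e₆ + c₃ * e₇ * d + c₃ * e₈ * Fintype.card n)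
        (c₄ * e₀ + c₆ * e₄ + c₇ * e₄ * s₁)
        (c₄ * e₁ * k + c₅ * e₀ + c₅ * e₁ * Fintype.card m + c₆ * e₅ + c₇ * e₄ * s₂ +
          c₇ * e₅ * d + c₈ * e₄ * r + c₈ * e₅ * Fintype.card n)
        (c₄ * e₂ * b₁ + c₆ * e₆ + c₇ * e₇ * d₁)
        (c₄ * e₂ * b₂ + c₆ * e₇ + c₇ * e₆ + c₇ * e₇ * d₂)
        (c₄ * e₂ * b₃ + c₄ * e₃ * k + c₅ * e₂ * k + c₅ * e₃ * Fintype.card m + c₇ * e₇ * d₃ +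
          c₆ * e₈ + c₈ * e₆ + c₇ * e₈ * d + c₈ * e₇ * d + c₈ * e₈ * Fintype.card n) := by
  have hMX : M * X = s₁ • M + s₂ • 𝟙 := by
    have h := congrArg Matrix.transpose hXMt
    rw [Matrix.transpose_mul, hXt, Matrix.transpose_transpose] at h
    rw [h]
    rfl
  have hMJ : M * (𝟙 : Matrix n n ℝ) = r • (𝟙 : Matrix m n ℝ) := Matrix.mul_allOnes hrow
  have hMJ' : M * (𝟙 : Matrix n m ℝ) = r • (𝟙 : Matrix m m ℝ) := Matrix.mul_allOnes hrow
  have hJM : (𝟙 : Matrix m m ℝ) * M = k • (𝟙 : Matrix m n ℝ) := Matrix.allOnes_mul hcol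
  have hJM' : (𝟙 : Matrix n m ℝ) * M = k • (𝟙 : Matrix n n ℝ) := Matrix.allOnes_mul hcol
  have hMtJ : Mᵀ * (𝟙 : Matrix m m ℝ) = k • (𝟙 : Matrix n m ℝ) :=
    Matrix.mul_allOnes (by simpa using hcol)
  have hMtJ' : Mᵀ * (𝟙 : Matrix m n ℝ) = k • (𝟙 : Matrix n n ℝ) :=
    Matrix.mul_allOnes (by simpa using hcol)
  have hJMt : (𝟙 : Matrix n n ℝ) * Mᵀ = r • (𝟙 : Matrix n m ℝ) :=
    Matrix.allOnes_mul (by simpa using hrow)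
  have hJMt' : (𝟙 : Matrix m n ℝ) * Mᵀ = r • (𝟙 : Matrix m m ℝ) :=
    Matrix.allOnes_mul (by simpa using hrow)
  have hX' : ∀ j, ∑ i, X i j = d := fun j => by
    rw [← hX j]
    exact Finset.sum_congr rfl fun i _ => congrFun (congrFun hXt j) i
  have hXJ : X * (𝟙 : Matrix n n ℝ) = d • (𝟙 : Matrix n n ℝ) := Matrix.mul_allOnes hX
  have hXJ' : X * (𝟙 : Matrix n m ℝ) = d • (𝟙 : Matrix n m ℝ) := Matrix.mul_allOnes hX
  have hJX : (𝟙 : Matrix n n ℝ) * X = d • (𝟙 : Matrix n n ℝ) := Matrix.allOnes_mul hX'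
  have hJX' : (𝟙 : Matrix m n ℝ) * X = d • (𝟙 : Matrix m n ℝ) := Matrix.allOnes_mul hX'
  simp only [blockCombination, Matrix.fromBlocks_multiply, Matrix.fromBlocks_inj]
  refine ⟨?_, ?_, ?_, ?_⟩ <;>
  · simp only [Matrix.add_mul, Matrix.mul_add, Matrix.smul_mul, Matrix.mul_smul, Matrix.one_mul,
      Matrix.mul_one, hMMt, hMtM, hXMt, hXX, hMX, hMJ, hMJ', hJM, hJM', hMtJ, hMtJ', hJMt, hJMt',
      hXJ, hXJ', hJX, hJX', Matrix.allOnes_mul_allOnes]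
    module

theorem isCoherentConfig_blockRelations {r k d a₁ a₂ b₁ b₂ b₃ s₁ s₂ d₁ d₂ d₃ : ℝ}
    (hM01 : ∀ i j, M i j = 0 ∨ M i j = 1) (hX01 : ∀ i j, X i j = 0 ∨ X i j = 1)
    (hXdiag : ∀ i, X i i = 0)
    (hrow : ∀ i, ∑ j, M i j = r) (hcol : ∀ j, ∑ i, M i j = k) (hX : ∀ i, ∑ j, X i j = d)
    (hXt : Xᵀ = X) (hMMt : M * Mᵀ = a₁ • (1 : Matrix m m ℝ) + a₂ • 𝟙)
    (hMtM : Mᵀ * M = b₁ • (1 : Matrix n n ℝ) + b₂ • X + b₃ • 𝟙)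
    (hXMt : X * Mᵀ = s₁ • Mᵀ + s₂ • 𝟙)
    (hXX : X * X = d₁ • (1 : Matrix n n ℝ) + d₂ • X + d₃ • 𝟙) :
    IsCoherentConfig (blockRelations M X) := by
  refine ⟨?_, ?_, ?_, ⟨{0, 6}, ?_⟩, fun i j => ?_⟩
  · have hM1 : ∀ i j, 1 - M i j = 0 ∨ M i j = 0 := fun i j => by
      rcases hM01 i j with h | h <;> simp [h]
    have h1 : ∀ i j, (1 : Matrix m m ℝ) i j = 0 ∨ (1 : Matrix m m ℝ) i j = 1 := fun i j => by
      by_cases h : i = j <;> simp [Matrix.one_apply, h]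
    have h1' : ∀ i j, (1 : Matrix n n ℝ) i j = 0 ∨ (1 : Matrix n n ℝ) i j = 1 := fun i j => by
      by_cases h : i = j <;> simp [Matrix.one_apply, h]
    have h2 : ∀ i j, 1 - (1 : Matrix m m ℝ) i j = 0 ∨ (1 : Matrix m m ℝ) i j = 0 :=
      fun i j => by rcases h1 i j with h | h <;> simp [h]
    have h3 : ∀ i j, 1 - (1 : Matrix n n ℝ) i j - X i j = 0 ∨
        1 - (1 : Matrix n n ℝ) i j - X i j = 1 := fun i j => by
      by_cases h : i = j
      · subst h
        simp [hXdiag]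
      · rcases hX01 i j with h' | h' <;> simp [h, h']
    intro l
    fin_cases l <;> rintro (i | i) (j | j) <;>
      simp only [blockRelations] <;> simp [hM01, hX01, hM1, h1, h1', h2, h3]
  · simp only [Fin.sum_univ_succ, Fin.sum_univ_zero, blockRelations]
    ext (i | i) (j | j) <;> simp
  · intro l
    refine ⟨![0, 1, 4, 5, 2, 3, 6, 7, 8] l, ?_⟩
    have hJ : ∀ {p q : Type}, (𝟙 : Matrix p q ℝ)ᵀ = 𝟙 := rfl
    fin_cases l <;> simp [blockRelations, Matrix.fromBlocks_transpose, hXt, hJ]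
  · rw [Finset.sum_pair (by decide)]
    simp [blockRelations, Matrix.fromBlocks_add]
  · obtain ⟨c₀, c₁, c₂, c₃, c₄, c₅, c₆, c₇, c₈, hi⟩ := exists_blockRelations_eq M X i
    obtain ⟨e₀, e₁, e₂, e₃, e₄, e₅, e₆, e₇, e₈, hj⟩ := exists_blockRelations_eq M X j
    rw [hi, hj, blockCombination_mul hrow hcol hX hXt hMMt hMtM hXMt hXX]
    exact blockCombination_mem_span _ _ _ _ _ _ _ _ _ _ _

end RankNine

/-- Converse construction for coherent rank 9, total-graph case: under the stated parameter
identities, the graph with block adjacency matrix `[[O, M],[Mᵀ, X]]` is connected with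
eigenvalue set exactly `{e0 - θ2, θ1, θ2}`, and if `r ≠ k + e0` it has coherent rank `9`. -/
theorem stmt9 (θ1 θ2 : ℤ) (hθ1 : 1 ≤ θ1) (hθ2 : θ2 ≤ -2)
    (v b k r lam : ℕ) (hv : 0 < v) (hb : 0 < b) (hk : 0 < k) (hr : 0 < r) (hlam : 0 < lam)
    (x y : ℤ) (hxy : x ≠ y)
    (M : Matrix (Fin v) (Fin b) ℝ)
    (hM01 : ∀ i j, M i j = 0 ∨ M i j = 1)
    (hrow : ∀ i, ∑ j, M i j = (r : ℝ))
    (hcol : ∀ j, ∑ i, M i j = (k : ℝ))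
    (hMMt : M * Mᵀ = ((r : ℝ) - lam) • (1 : Matrix (Fin v) (Fin v) ℝ)
      + (lam : ℝ) • Matrix.of (fun _ _ => 1))
    (X : Matrix (Fin b) (Fin b) ℝ)
    (hXsymm : Xᵀ = X) (hXdiag : ∀ i, X i i = 0) (hX01 : ∀ i j, X i j = 0 ∨ X i j = 1)
    (hMtM : Mᵀ * M = (k : ℝ) • (1 : Matrix (Fin b) (Fin b) ℝ) + (x : ℝ) • X
      + (y : ℝ) • (Matrix.of (fun _ _ => 1) - (1 : Matrix (Fin b) (Fin b) ℝ) - X))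
    (H : SimpleGraph (Fin b)) [DecidableRel H.Adj]
    (hH : SimpleGraph.adjMatrix ℝ H = X)
    (hHconn : H.Connected)
    (e0 e1 e2 : ℝ) (he01 : e1 < e0) (he12 : e2 < e1)
    (hHeig : {θ : ℝ | adjEig H θ} = {e0, e1, e2})
    (hx : (x : ℝ) = (k : ℝ) + ((θ1 : ℝ) + 1) * ((θ2 : ℝ) + 1) - (e1 + 1) * (e2 + 1))
    (hy : (y : ℝ) = (k : ℝ) + (θ1 : ℝ) * (θ2 : ℝ) - e1 * e2)
    (hl : (lam : ℝ) = (r : ℝ) + (θ1 : ℝ) * (θ2 : ℝ))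
    (hratio : ((r : ℝ) - (lam : ℝ) + (y : ℝ) - (k : ℝ)) / ((x : ℝ) - (y : ℝ))
      = (θ1 : ℝ) + (θ2 : ℝ))
    (hsqrt : ((lam : ℝ) * (k : ℝ) - (y : ℝ) * (r : ℝ)) / ((x : ℝ) - (y : ℝ))
      = Real.sqrt ((lam : ℝ) * ((k : ℝ) + e0 + (θ1 : ℝ) * (θ2 : ℝ)))) :
    ∀ (G : SimpleGraph (Fin v ⊕ Fin b)) [DecidableRel G.Adj],
      SimpleGraph.adjMatrix ℝ G = Matrix.fromBlocks 0 M Mᵀ X →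
      G.Connected ∧
      {θ : ℝ | adjEig G θ} = {e0 - (θ2 : ℝ), (θ1 : ℝ), (θ2 : ℝ)} ∧
      (θ1 : ℝ) < e0 - (θ2 : ℝ) ∧
      ((r : ℝ) ≠ (k : ℝ) + e0 → HasCoherentRank G 9) := by
  intro G _ hG
  have : Nonempty (Fin v) := ⟨⟨0, hv⟩⟩
  have : Nonempty (Fin b) := ⟨⟨0, hb⟩⟩
  have hxy' : (x : ℝ) - y ≠ 0 := sub_ne_zero.2 (by exact_mod_cast hxy)
  have hθ1' : (1 : ℝ) ≤ θ1 := by exact_mod_cast hθ1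
  have hθ2' : (θ2 : ℝ) ≤ -2 := by exact_mod_cast hθ2
  have hk' : (0 : ℝ) < k := by exact_mod_cast hk
  have hr' : (0 : ℝ) < r := by exact_mod_cast hr
  have hl' : (0 : ℝ) < lam := by exact_mod_cast hlam
  have hb' : (0 : ℝ) < b := by exact_mod_cast hb
  have hθθ : (θ1 : ℝ) * θ2 < 0 := mul_neg_of_pos_of_neg (by linarith) (by linarith)
  -- `H` is regular of degree `e0`
  have hMtJ : Mᵀ * (𝟙 : Matrix (Fin v) (Fin b) ℝ) = (k : ℝ) • 𝟙 :=
    Matrix.mul_allOnes (by simpa using hcol)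
  have hMJ : M * (𝟙 : Matrix (Fin b) (Fin b) ℝ) = (r : ℝ) • 𝟙 := Matrix.mul_allOnes hrow
  have hMtM' : Mᵀ * M = ((k : ℝ) - y) • (1 : Matrix (Fin b) (Fin b) ℝ) + ((x : ℝ) - y) • X +
      (y : ℝ) • 𝟙 := by
    rw [hMtM]
    module
  have hdeg : ∀ i, (H.degree i : ℝ) = ∑ j, X i j := fun i => by
    rw [← hH, ← SimpleGraph.card_neighborFinset_eq_degree, SimpleGraph.neighborFinset_eq_filter]
    simp [SimpleGraph.adjMatrix_apply]
  have hXrow : ∀ i, ∑ j, X i j = e0 := by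
    have hXsum : ∀ i, ∑ j, X i j = (r * k - (k - y) - y * b) / ((x : ℝ) - y) := by
      intro i
      have h1 : Mᵀ * M * (𝟙 : Matrix (Fin b) (Fin b) ℝ) = ((r : ℝ) * k) • 𝟙 := by
        rw [Matrix.mul_assoc, hMJ, Matrix.mul_smul, hMtJ, smul_smul]
      rw [hMtM', Matrix.add_mul, Matrix.add_mul, Matrix.smul_mul, Matrix.smul_mul,
        Matrix.smul_mul, Matrix.one_mul, Matrix.allOnes_mul_allOnes] at h1
      have h2 := congrFun (congrFun h1 i) i
      simp [Matrix.mul_apply] at h2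
      rw [eq_div_iff hxy']
      linarith
    have := degree_eq_of_adjEig (fun i => (hdeg i).trans (hXsum i)) he01 he12 hHeig
    exact fun i => (hXsum i).trans this
  have hd : ∀ i, (H.degree i : ℝ) = e0 := fun i => (hdeg i).trans (hXrow i)
  have he0 : 0 ≤ e0 := by
    rw [← hd (Classical.arbitrary _)]
    positivity
  have hXX : X * X = (-(e1 * e2)) • (1 : Matrix (Fin b) (Fin b) ℝ) + (e1 + e2) • X +
      (e0 + e1 * e2) • 𝟙 := by
    have h := adjMatrix_sq_of_three_eigenvalues hHconn hd hHeig
    rw [hH] at h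
    rw [h]
    module
  have hXJ : X * (𝟙 : Matrix (Fin b) (Fin b) ℝ) = e0 • 𝟙 := Matrix.mul_allOnes hXrow
  have hXcol : ∀ j, ∑ i, X i j = e0 := fun j => by
    rw [← hXrow j]
    exact Finset.sum_congr rfl fun i _ => congrFun (congrFun hXsymm j) i
  -- eigenvectors of `X` orthogonal to the all-ones vector
  have heigvec : ∀ e, e = e1 ∨ e = e2 → ∃ u : Fin b → ℝ, u ≠ 0 ∧ X *ᵥ u = e • u ∧
      (𝟙 : Matrix (Fin b) (Fin b) ℝ) *ᵥ u = 0 := by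
    intro e he
    have hmem : e ∈ {θ : ℝ | adjEig H θ} := by
      rw [hHeig]
      exact Or.inr he
    obtain ⟨u, hu0, hu⟩ := hmem
    rw [hH] at hu
    refine ⟨u, hu0, hu, ?_⟩
    have h1 : (𝟙 : Matrix (Fin b) (Fin b) ℝ) * X = e0 • 𝟙 := Matrix.allOnes_mul hXcol
    have h2 := congrArg (· *ᵥ u) h1
    simp only [← Matrix.mulVec_mulVec, hu, Matrix.mulVec_smul, Matrix.smul_mulVec] at h2
    rw [← sub_eq_zero, ← sub_smul, smul_eq_zero] at h2
    refine h2.resolve_left (sub_ne_zero.2 ?_)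
    rcases he with rfl | rfl <;> linarith
  -- a pair of distinct nonadjacent vertices of `H`
  obtain ⟨q0, q0', hq0, hX0⟩ : ∃ q q', q ≠ q' ∧ X q q' = 0 := by
    by_contra! hall
    have hX1 : X = 𝟙 - 1 := by
      ext i j
      by_cases hij : i = j
      · simp [hij, hXdiag]
      · simp [hij, (hX01 i j).resolve_left (hall i j hij)]
    have hval : ∀ e, e = e1 ∨ e = e2 → e = -1 := by
      intro e he
      obtain ⟨u, hu0, hu, hJu⟩ := heigvec e he
      rw [hX1, Matrix.sub_mulVec, hJu, Matrix.one_mulVec, zero_sub, ← neg_one_smul ℝ u,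
        ← sub_eq_zero, ← sub_smul, smul_eq_zero] at hu
      have := hu.resolve_right hu0
      linarith
    linarith [hval e1 (Or.inl rfl), hval e2 (Or.inr rfl)]
  -- an edge of `H`
  obtain ⟨q, q', hX1⟩ : ∃ q q', X q q' = 1 := by
    by_contra! hall
    have hX1 : X = 0 := by
      ext i j
      exact (hX01 i j).resolve_right (hall i j)
    have hval : ∀ e, e = e1 ∨ e = e2 → e = 0 := by
      intro e he
      obtain ⟨u, hu0, hu, -⟩ := heigvec e he
      rw [hX1, Matrix.zero_mulVec, eq_comm, smul_eq_zero] at hu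
      exact hu.resolve_right hu0
    linarith [hval e1 (Or.inl rfl), hval e2 (Or.inr rfl)]
  -- `M` is neither zero nor all ones, and has at least two rows
  have hM11 : M * Mᵀ = (-((θ1 : ℝ) * θ2)) • (1 : Matrix (Fin v) (Fin v) ℝ) +
      (lam : ℝ) • 𝟙 := by
    rw [hMMt, hl]
    congr 2
    ring
  obtain ⟨i1, j1, hM1⟩ : ∃ i j, M i j = 1 := by
    by_contra! hall
    have := hrow (Classical.arbitrary _)
    rw [Finset.sum_eq_zero fun j _ => (hM01 _ j).resolve_right (hall _ j)] at this
    linarith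
  obtain ⟨i0, j0, hM0⟩ : ∃ i j, M i j = 0 := by
    by_contra! hall
    have hM : ∀ i j, M i j = 1 := fun i j => (hM01 i j).resolve_left (hall i j)
    have h1 := congrFun (congrFun hMtM' q) q'
    have h2 := congrFun (congrFun hMtM' q0) q0'
    have hqq : q ≠ q' := by
      rintro rfl
      rw [hXdiag] at hX1
      exact zero_ne_one hX1
    simp [Matrix.mul_apply, hM, hqq, hX1] at h1
    simp [Matrix.mul_apply, hM, hq0, hX0] at h2
    exact hxy' (by linarith)
  obtain ⟨p, p', hp⟩ : ∃ p p' : Fin v, p ≠ p' := by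
    by_contra! hall
    have h1 := hrow i0
    have h2 := hcol j0
    have h3 : ∑ i, M i j0 = 0 := Finset.sum_eq_zero fun i _ => by rw [hall i i0, hM0]
    linarith
  -- the blocks of the square of the adjacency matrix
  have hy0 : (0 : ℝ) ≤ y := by
    have h := congrFun (congrFun hMtM' q0) q0'
    simp [hq0, hX0] at h
    rw [← h, Matrix.mul_apply]
    refine Finset.sum_nonneg fun i _ => mul_nonneg ?_ ?_
    · rw [Matrix.transpose_apply]
      rcases hM01 i q0 with h | h <;> simp [h]
    · rcases hM01 i q0' with h | h <;> simp [h]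
  have hc0 : 0 < e0 + e1 * e2 := by
    have h1 : X * X * (𝟙 : Matrix (Fin b) (Fin b) ℝ) = (e0 * e0) • 𝟙 := by
      rw [Matrix.mul_assoc, hXJ, Matrix.mul_smul, hXJ, smul_smul]
    rw [hXX, Matrix.add_mul, Matrix.add_mul, Matrix.smul_mul, Matrix.smul_mul, Matrix.smul_mul,
      Matrix.one_mul, hXJ, Matrix.allOnes_mul_allOnes] at h1
    have h2 := congrFun (congrFun h1 q) q
    simp at h2
    have h3 : (e0 + e1 * e2) * b = (e0 - e1) * (e0 - e2) := by linarith
    have h4 : 0 < (e0 + e1 * e2) * b := by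
      rw [h3]
      exact mul_pos (by linarith) (by linarith)
    exact pos_of_mul_pos_left h4 hb'.le
  set t : ℝ := k + e0 + θ1 * θ2 with ht
  have ht0 : 0 < t := by linarith
  have hX22 : Mᵀ * M + X * X = ((θ1 : ℝ) + θ2) • X - ((θ1 : ℝ) * θ2) • 1 + t • 𝟙 := by
    have h1 : (k : ℝ) - y = e1 * e2 - θ1 * θ2 := by linarith
    have h2 : (x : ℝ) - y = θ1 + θ2 - (e1 + e2) := by
      rw [hx, hy]
      ring
    have h3 : (y : ℝ) = t - (e0 + e1 * e2) := by linarith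
    rw [hMtM', hXX, h1, h2, h3]
    module
  have hXMt : X * Mᵀ = ((θ1 : ℝ) + θ2) • Mᵀ + √(lam * t) • 𝟙 := by
    have hJMt : (𝟙 : Matrix (Fin b) (Fin b) ℝ) * Mᵀ = (r : ℝ) • 𝟙 :=
      Matrix.allOnes_mul (by simpa using hrow)
    have hMtJ' : Mᵀ * (𝟙 : Matrix (Fin v) (Fin v) ℝ) = (k : ℝ) • 𝟙 :=
      Matrix.mul_allOnes (by simpa using hcol)
    have h := Matrix.mul_assoc Mᵀ M Mᵀ
    rw [hMMt, hMtM', Matrix.add_mul, Matrix.add_mul, Matrix.mul_add, Matrix.smul_mul,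
      Matrix.smul_mul, Matrix.smul_mul, Matrix.mul_smul, Matrix.mul_smul, Matrix.one_mul,
      Matrix.mul_one, hJMt, hMtJ'] at h
    have h' : ((x : ℝ) - y) • (X * Mᵀ) =
        ((r : ℝ) - lam + y - k) • Mᵀ + ((lam : ℝ) * k - y * r) • 𝟙 := by
      rw [← sub_eq_zero] at h ⊢
      rw [← h]
      module
    rw [← hratio, ← hsqrt, ← (smul_right_injective _ hxy').eq_iff]
    change ((x : ℝ) - y) • (X * Mᵀ) = ((x : ℝ) - y) • _
    rw [h', smul_add, smul_smul, smul_smul, mul_div_cancel₀ _ hxy', mul_div_cancel₀ _ hxy']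
  have hMX : M * X = ((θ1 : ℝ) + θ2) • M + √(lam * t) • 𝟙 := by
    have h := congrArg Matrix.transpose hXMt
    rw [Matrix.transpose_mul, hXsymm, Matrix.transpose_transpose] at h
    rw [h]
    rfl
  set w : Fin v ⊕ Fin b → ℝ := Sum.elim (fun _ => √lam) (fun _ => √t) with hw_def
  have hw : ∀ i, 0 < w i := by
    rintro (i | i)
    · exact Real.sqrt_pos.2 hl'
    · exact Real.sqrt_pos.2 ht0
  have hK : Matrix.vecMulVec w w =
      Matrix.fromBlocks ((lam : ℝ) • 𝟙) (√(lam * t) • 𝟙) (√(lam * t) • 𝟙) (t • 𝟙) := by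
    ext (i | i) (j | j) <;>
      simp [hw_def, Matrix.vecMulVec_apply, Real.mul_self_sqrt, hl'.le, ht0.le,
        Real.sqrt_mul, mul_comm]
  have hA : Matrix.fromBlocks 0 M Mᵀ X * Matrix.fromBlocks 0 M Mᵀ X =
      ((θ1 : ℝ) + θ2) • Matrix.fromBlocks 0 M Mᵀ X -
        ((θ1 : ℝ) * θ2) • (1 : Matrix (Fin v ⊕ Fin b) (Fin v ⊕ Fin b) ℝ) +
        Matrix.vecMulVec w w := by
    rw [hK, ← Matrix.fromBlocks_one, Matrix.fromBlocks_multiply, Matrix.fromBlocks_smul,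
      Matrix.fromBlocks_smul, sub_eq_add_neg, Matrix.fromBlocks_neg, Matrix.fromBlocks_add,
      Matrix.fromBlocks_add, Matrix.fromBlocks_inj]
    refine ⟨?_, ?_, ?_, ?_⟩
    · rw [hM11, Matrix.zero_mul]
      module
    · rw [hMX, Matrix.zero_mul]
      module
    · rw [hXMt, Matrix.mul_zero]
      module
    · rw [hX22]
      module
  -- an eigenvector of `X` for `θ1 + θ2`
  obtain ⟨u, hu0, hXu, hJu⟩ := heigvec (θ1 + θ2) (by
    have h1 : (r : ℝ) - lam + y - k = (θ1 + θ2) * (x - y) := (div_eq_iff hxy').1 hratio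
    have h2 : ((θ1 : ℝ) + θ2 - e1) * (θ1 + θ2 - e2) = 0 := by
      rw [hx, hy, hl] at h1
      linear_combination -h1
    rcases mul_eq_zero.1 h2 with h | h
    · exact Or.inl (by linarith)
    · exact Or.inr (by linarith))
  have hMu : Mᵀ *ᵥ (M *ᵥ u) = (-((θ1 : ℝ) * θ2)) • u := by
    have h := congrArg (· *ᵥ u) hX22
    simp only [Matrix.add_mulVec, Matrix.sub_mulVec, Matrix.smul_mulVec, ← Matrix.mulVec_mulVec,
      hXu, hJu, Matrix.one_mulVec, Matrix.mulVec_smul] at h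
    rw [← sub_eq_zero] at h ⊢
    rw [← h]
    module
  obtain ⟨hspec, hgap⟩ := eigenvalues_fromBlocks hr' hk' (by linarith) (by linarith) he0
    (Real.sqrt_pos.2 hl') (Real.sqrt_pos.2 ht0) hrow hcol hXrow hA hu0 hXu hMu
  refine ⟨?_, ?_, hgap, fun hne => ⟨?_, ?_⟩⟩
  · exact SimpleGraph.connected_of_adjMatrix_sq hw (by rw [hG]; exact hA)
  · rw [← hspec, ← hG]
    rfl
  · refine ⟨blockRelations M X, ?_, ?_⟩
    · exact isCoherentConfig_blockRelations hM01 hX01 hXdiag hrow hcol hXrow hXsymm hM11 hMtM'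
        hXMt hXX
    · rw [hG]
      exact fromBlocks_mem_span_blockRelations M X
  · rintro ρ ⟨A, hAcc, hAmem⟩
    rw [hG] at hAmem
    refine hAcc.nine_le hAmem (K := Matrix.vecMulVec w w) ?_ ?_ ?_ hp hM0 hM1 hX1 (hXdiag q)
      hX0 hq0
    · have h := Submodule.add_mem _ (Submodule.sub_mem _ (hAcc.mul_mem hAmem hAmem)
        (Submodule.smul_mem _ ((θ1 : ℝ) + θ2) hAmem))
        (Submodule.smul_mem _ ((θ1 : ℝ) * θ2) hAcc.one_mem)
      rw [hA] at h
      convert h using 1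
      abel
    · intro i j
      rw [Matrix.vecMulVec_apply]
      exact (mul_pos (hw i) (hw j)).ne'
    · intro i j h
      simp only [hK, Matrix.fromBlocks_apply₁₁, Matrix.fromBlocks_apply₂₂, Matrix.smul_apply,
        Matrix.of_apply, smul_eq_mul, mul_one] at h
      exact hne (by linarith)
end

section
/- Let θ1 ≥ 1 and θ2 ≤ −2 be integers. Let v, b, k, r, λ be positive integers and x, y integers with x ≠ y. Let M be a v×b {0,1}-matrix with all row sums r and all column sums k satisfying M·Mᵀ = (r−λ)·I + λ·J, and let X be a symmetric b×b {0,1}-matrix with zero diagonal satisfying Mᵀ·M = k·I + x·X + y·(J − I − X). Assume the graph with adjacency matrix X is connected and its set of eigenvalues is exactly {e0, e1, e2} with e0 > e1 > e2. Assume x = k + (θ1+1)(θ2+1) − (e1+1)(e2+1), y = k + θ1·θ2 − e1·e2, λ = r + (θ1+1)(θ2+1), (r − λ + y − k)/(x − y) = θ1 + θ2 + 1, and k + (λ·k − y·r)/(x − y) = √((v − 1 + r + θ1·θ2)·(k + e0 + θ1·θ2)). Then the graph on v+b vertices with block adjacency matrix [[J−I, M],[Mᵀ, X]] is connected and its set of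 adjacency eigenvalues is exactly {θ0, θ1, θ2}, where θ0 = (v − 1 + e0 + √((v − 1 − e0)² + 4·r·k))/2. Furthermore, if v − 1 + r ≠ k + e0 then this graph has coherent rank 9. -/
open Matrix

local notation "𝐉" => Matrix.of (fun _ _ => (1 : ℝ))

section OnesMatrix

variable {l m n : Type}

lemma mul_ones_of_rowSum [Fintype n] (A : Matrix m n ℝ) {c : ℝ} (h : ∀ i, ∑ j, A i j = c) :
    A * (𝐉 : Matrix n l ℝ) = c • 𝐉 := by
  ext i j
  simp [Matrix.mul_apply, h]

lemma ones_mul_of_colSum [Fintype m] (A : Matrix m n ℝ) {c : ℝ} (h : ∀ j, ∑ i, A i j = c) :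
    (𝐉 : Matrix l m ℝ) * A = c • 𝐉 := by
  ext i j
  simp [Matrix.mul_apply, h]

lemma ones_mul_ones [Fintype m] :
    (𝐉 : Matrix l m ℝ) * (𝐉 : Matrix m n ℝ) = (Fintype.card m : ℝ) • 𝐉 :=
  mul_ones_of_rowSum _ (by simp)

lemma transpose_ones : (𝐉 : Matrix m n ℝ)ᵀ = 𝐉 := rfl

end OnesMatrix

section RegularGraph

variable {V : Type} [Fintype V] (H : SimpleGraph V) [DecidableRel H.Adj] {d : ℝ}

lemma degree_of_rowSum (hd : ∀ i, ∑ j, H.adjMatrix ℝ i j = d) (i : V) : (H.degree i : ℝ) = d := by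
  rw [← hd i]
  simp [SimpleGraph.adjMatrix_apply, ← SimpleGraph.card_neighborFinset_eq_degree,
    SimpleGraph.neighborFinset_eq_filter]

lemma sum_eq_zero_of_mulVec_eq_smul (hd : ∀ i, ∑ j, H.adjMatrix ℝ i j = d) {e : ℝ} (he : e ≠ d)
    {f : V → ℝ} (hf : H.adjMatrix ℝ *ᵥ f = e • f) : ∑ i, f i = 0 := by
  have hcol : ∀ j, ∑ i, H.adjMatrix ℝ i j = d := fun j => by
    rw [← hd j]
    exact Finset.sum_congr rfl fun i _ => by simp [SimpleGraph.adjMatrix_apply, H.adj_comm]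
  have h : ∑ i, (H.adjMatrix ℝ *ᵥ f) i = d * ∑ i, f i := by
    simp only [Matrix.mulVec, dotProduct]
    rw [Finset.sum_comm, Finset.mul_sum]
    exact Finset.sum_congr rfl fun j _ => by rw [← Finset.sum_mul, hcol]
  rw [hf] at h
  simp only [Pi.smul_apply, smul_eq_mul, ← Finset.mul_sum] at h
  have : (e - d) * ∑ i, f i = 0 := by linear_combination h
  exact (mul_eq_zero.mp this).resolve_left (sub_ne_zero.mpr he)

variable [DecidableEq V]

lemma le_of_adjEig_of_rowSum (hd : ∀ i, ∑ j, H.adjMatrix ℝ i j = d) {e : ℝ} (he : adjEig H e) :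
    e ≤ d := by
  obtain ⟨f, hf, hfe⟩ := he
  obtain ⟨i₀, hi₀⟩ := Function.ne_iff.mp hf
  have : Nonempty V := ⟨i₀⟩
  obtain ⟨i, hi⟩ := Finite.exists_max fun j => |f j|
  have hpos : 0 < |f i| := (abs_pos.mpr hi₀).trans_le (hi i₀)
  have hmul : ∑ j, H.adjMatrix ℝ i j * f j = e * f i := by
    simpa [Matrix.mulVec, dotProduct] using congrFun hfe i
  have hle : |e| * |f i| ≤ d * |f i| := by
    rw [← abs_mul, ← hmul, ← hd i, Finset.sum_mul]
    refine (Finset.abs_sum_le_sum_abs _ _).trans (Finset.sum_le_sum fun j _ => ?_)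
    rw [SimpleGraph.adjMatrix_apply]
    split_ifs <;> simp [hi j]
  exact (le_abs_self e).trans (le_of_mul_le_mul_right hle hpos)

lemma adjEig_of_rowSum [Nonempty V] (hd : ∀ i, ∑ j, H.adjMatrix ℝ i j = d) : adjEig H d :=
  ⟨fun _ => 1, Function.ne_iff.mpr ⟨Classical.arbitrary V, one_ne_zero⟩, by
    ext i
    simpa [Matrix.mulVec, dotProduct] using hd i⟩

lemma eq_const_of_mulVec_eq_smul (hH : H.Connected) (hd : ∀ i, ∑ j, H.adjMatrix ℝ i j = d)
    {f : V → ℝ} (hf : H.adjMatrix ℝ *ᵥ f = d • f) (i j : V) : f i = f j := by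
  refine (SimpleGraph.lapMatrix_mulVec_eq_zero_iff_forall_reachable H).mp ?_ i j
    (hH.preconnected i j)
  rw [SimpleGraph.lapMatrix, Matrix.sub_mulVec, hf]
  ext i
  simp [SimpleGraph.degMatrix, degree_of_rowSum H hd]

/-- The product of `A - e` over the eigenvalues `e` of the adjacency matrix `A` vanishes. -/
lemma adjMatrix_mul_eq_zero_of_eigs {e0 e1 e2 : ℝ} (he : {θ : ℝ | adjEig H θ} = {e0, e1, e2}) :
    (H.adjMatrix ℝ - e0 • 1) * ((H.adjMatrix ℝ - e1 • 1) * (H.adjMatrix ℝ - e2 • 1)) = 0 := by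
  have hX : (H.adjMatrix ℝ).IsHermitian := by
    simp [Matrix.IsHermitian, Matrix.conjTranspose_eq_transpose_of_trivial]
  set P := (H.adjMatrix ℝ - e0 • 1) * ((H.adjMatrix ℝ - e1 • 1) * (H.adjMatrix ℝ - e2 • 1))
    with hP
  have hPU : P * (hX.eigenvectorUnitary : Matrix V V ℝ) = 0 := by
    ext i j
    set u : V → ℝ := ⇑(hX.eigenvectorBasis j) with hu
    have hXu : H.adjMatrix ℝ *ᵥ u = hX.eigenvalues j • u := hX.mulVec_eigenvectorBasis j
    have hu0 : u ≠ 0 := fun h => hX.eigenvectorBasis.orthonormal.ne_zero j (by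
      ext i
      exact congrFun h i)
    have hmem : hX.eigenvalues j ∈ ({e0, e1, e2} : Set ℝ) := he ▸ ⟨u, hu0, hXu⟩
    have hPu : P *ᵥ u = 0 := by
      have key (e : ℝ) : (H.adjMatrix ℝ - e • 1) *ᵥ u = (hX.eigenvalues j - e) • u := by
        rw [Matrix.sub_mulVec, hXu, Matrix.smul_mulVec, Matrix.one_mulVec, sub_smul]
      rw [hP, ← Matrix.mulVec_mulVec, ← Matrix.mulVec_mulVec, key, Matrix.mulVec_smul, key,
        Matrix.mulVec_smul, Matrix.mulVec_smul, key, smul_smul, smul_smul]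
      rcases hmem with h | h | h <;> simp [show hX.eigenvalues j = _ from h]
    exact congrFun hPu i
  calc P = P * ((hX.eigenvectorUnitary : Matrix V V ℝ)
          * star (hX.eigenvectorUnitary : Matrix V V ℝ)) := by simp
    _ = 0 := by rw [← mul_assoc, hPU, zero_mul]

/-- A connected regular graph with three eigenvalues is strongly regular. -/
lemma adjMatrix_mul_self_of_eigs (hH : H.Connected) {e0 e1 e2 : ℝ}
    (hd : ∀ i, ∑ j, H.adjMatrix ℝ i j = e0) (he : {θ : ℝ | adjEig H θ} = {e0, e1, e2}) :
    H.adjMatrix ℝ * H.adjMatrix ℝ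
      = (e1 + e2) • H.adjMatrix ℝ - (e1 * e2) • 1 + (e0 + e1 * e2) • 𝐉 := by
  have hzero := adjMatrix_mul_eq_zero_of_eigs H he
  set P := (H.adjMatrix ℝ - e1 • 1) * (H.adjMatrix ℝ - e2 • 1) with hP
  have hP' : P = H.adjMatrix ℝ * H.adjMatrix ℝ - (e1 + e2) • H.adjMatrix ℝ + (e1 * e2) • 1 := by
    rw [hP]
    simp only [sub_mul, mul_sub, Matrix.smul_mul, Matrix.mul_smul, one_mul, mul_one, smul_smul]
    module
  have hcol : ∀ i i' j, P i j = P i' j := fun i i' j =>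
    eq_const_of_mulVec_eq_smul H hH hd (f := fun i => P i j) (by
      rw [sub_mul, Matrix.smul_mul, one_mul, sub_eq_zero] at hzero
      ext i
      simpa [Matrix.mul_apply, Matrix.mulVec, dotProduct] using congrFun (congrFun hzero i) j) i i'
  have hdiag : ∀ i, P i i = e0 + e1 * e2 := fun i => by
    simp [hP', -SimpleGraph.mul_adjMatrix_apply, -SimpleGraph.adjMatrix_mul_apply,
      SimpleGraph.adjMatrix_mul_self_apply_self, degree_of_rowSum H hd]
  have hPJ : P = (e0 + e1 * e2) • 𝐉 := by
    ext i j
    simp [hcol i j j, hdiag]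
  rw [← hPJ, hP']
  module

end RegularGraph

section CoherentAlgebra

variable {V : Type} [Fintype V] [DecidableEq V] {n : ℕ} {A : Fin n → Matrix V V ℝ}

open Submodule in
lemma span_mul_mem {l m n : Type} [Fintype m] {s : Set (Matrix l m ℝ)} {t : Set (Matrix m n ℝ)}
    {U : Submodule ℝ (Matrix l n ℝ)} (h : ∀ P ∈ s, ∀ Q ∈ t, P * Q ∈ U)
    {P : Matrix l m ℝ} (hP : P ∈ span ℝ s) {Q : Matrix m n ℝ} (hQ : Q ∈ span ℝ t) :
    P * Q ∈ U := by
  induction hP, hQ using span_induction₂ with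
  | mem_mem P Q hP hQ => exact h P hP Q hQ
  | zero_left => simp
  | zero_right => simp
  | add_left P P' Q _ _ _ h h' => rw [Matrix.add_mul]; exact U.add_mem h h'
  | add_right P Q Q' _ _ _ h h' => rw [Matrix.mul_add]; exact U.add_mem h h'
  | smul_left c P Q _ _ h => rw [Matrix.smul_mul]; exact U.smul_mem c h
  | smul_right c P Q _ _ h => rw [Matrix.mul_smul]; exact U.smul_mem c h

namespace IsCoherentConfig

lemma one_mem_s10 (hA : IsCoherentConfig A) : 1 ∈ Submodule.span ℝ (Set.range A) := by
  obtain ⟨Δ, hΔ⟩ := hA.2.2.2.1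
  rw [← hΔ]
  exact Submodule.sum_mem _ fun i _ => Submodule.subset_span ⟨i, rfl⟩

lemma ones_mem (hA : IsCoherentConfig A) : 𝐉 ∈ Submodule.span ℝ (Set.range A) := by
  rw [← hA.2.1]
  exact Submodule.sum_mem _ fun i _ => Submodule.subset_span ⟨i, rfl⟩

lemma mul_mem_s10 (hA : IsCoherentConfig A) {P Q : Matrix V V ℝ}
    (hP : P ∈ Submodule.span ℝ (Set.range A)) (hQ : Q ∈ Submodule.span ℝ (Set.range A)) :
    P * Q ∈ Submodule.span ℝ (Set.range A) :=
  span_mul_mem (by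
    rintro _ ⟨i, rfl⟩ _ ⟨j, rfl⟩
    exact hA.2.2.2.2 i j) hP hQ

lemma hadamard_eq_zero (hA : IsCoherentConfig A) {i j : Fin n} (hij : i ≠ j) :
    A i ⊙ A j = 0 := by
  ext x y
  have hsum : ∑ k, A k x y = 1 := by
    simpa [Matrix.sum_apply] using congrFun (congrFun hA.2.1 x) y
  have hle : A i x y + A j x y ≤ 1 := by
    rw [← hsum, ← Finset.sum_pair hij (f := fun k => A k x y)]
    refine Finset.sum_le_sum_of_subset_of_nonneg (Finset.subset_univ _) fun k _ _ => ?_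
    rcases hA.1 k x y with h | h <;> simp [h]
  rcases hA.1 i x y with h | h <;> rcases hA.1 j x y with h' | h' <;>
    simp [Matrix.hadamard_apply, h, h']
  norm_num [h, h'] at hle

lemma hadamard_mem (hA : IsCoherentConfig A) {P Q : Matrix V V ℝ}
    (hP : P ∈ Submodule.span ℝ (Set.range A)) (hQ : Q ∈ Submodule.span ℝ (Set.range A)) :
    P ⊙ Q ∈ Submodule.span ℝ (Set.range A) := by
  induction hP, hQ using Submodule.span_induction₂ with
  | mem_mem P Q hP hQ =>
    obtain ⟨i, rfl⟩ := hP
    obtain ⟨j, rfl⟩ := hQ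
    by_cases hij : i = j
    · subst hij
      have hii : A i ⊙ A i = A i := by
        ext x y
        rcases hA.1 i x y with h | h <;> simp [h]
      rw [hii]
      exact Submodule.subset_span ⟨i, rfl⟩
    · rw [hA.hadamard_eq_zero hij]
      exact zero_mem _
  | zero_left => simp
  | zero_right => simp
  | add_left P P' Q _ _ _ h h' => rw [Matrix.add_hadamard]; exact Submodule.add_mem _ h h'
  | add_right P Q Q' _ _ _ h h' => rw [Matrix.hadamard_add]; exact Submodule.add_mem _ h h'
  | smul_left c P Q _ _ h => rw [Matrix.smul_hadamard]; exact Submodule.smul_mem _ c h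
  | smul_right c P Q _ _ h => rw [Matrix.hadamard_smul]; exact Submodule.smul_mem _ c h

end IsCoherentConfig

end CoherentAlgebra

section BlockFamily

variable {V B : Type} [DecidableEq V] [DecidableEq B]
  {M : Matrix V B ℝ} {X : Matrix B B ℝ}

/-- The nine block matrices of the coherent configuration attached to a quasi-symmetric design
with incidence matrix `M` and block graph with adjacency matrix `X`. -/
def blockFamily (M : Matrix V B ℝ) (X : Matrix B B ℝ) : Fin 9 → Matrix (V ⊕ B) (V ⊕ B) ℝ :=
  ![Matrix.fromBlocks 1 0 0 0, Matrix.fromBlocks (𝐉 - 1) 0 0 0,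
    Matrix.fromBlocks 0 M 0 0, Matrix.fromBlocks 0 (𝐉 - M) 0 0,
    Matrix.fromBlocks 0 0 Mᵀ 0, Matrix.fromBlocks 0 0 (𝐉 - Mᵀ) 0,
    Matrix.fromBlocks 0 0 0 1, Matrix.fromBlocks 0 0 0 X, Matrix.fromBlocks 0 0 0 (𝐉 - 1 - X)]

lemma fromBlocks_mem_span_blockFamily {P : Matrix V V ℝ} {Q : Matrix V B ℝ} {R : Matrix B V ℝ}
    {S : Matrix B B ℝ} (hP : P ∈ Submodule.span ℝ {1, 𝐉}) (hQ : Q ∈ Submodule.span ℝ {M, 𝐉})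
    (hR : R ∈ Submodule.span ℝ {Mᵀ, 𝐉}) (hS : S ∈ Submodule.span ℝ {1, X, 𝐉}) :
    Matrix.fromBlocks P Q R S ∈ Submodule.span ℝ (Set.range (blockFamily M X)) := by
  obtain ⟨p, p', rfl⟩ := Submodule.mem_span_pair.mp hP
  obtain ⟨q, q', rfl⟩ := Submodule.mem_span_pair.mp hQ
  obtain ⟨r, r', rfl⟩ := Submodule.mem_span_pair.mp hR
  obtain ⟨s, s', s'', rfl⟩ := Submodule.mem_span_triple.mp hS
  refine (Submodule.mem_span_range_iff_exists_fun ℝ).mpr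
    ⟨![p + p', p', q + q', q', r + r', r', s + s'', s' + s'', s''], ?_⟩
  simp only [Fin.sum_univ_succ, blockFamily]
  simp only [Matrix.cons_val_zero, Matrix.cons_val_succ, Fin.sum_univ_zero,
    Matrix.fromBlocks_smul, Matrix.fromBlocks_add, smul_zero, add_zero, zero_add]
  congr 1 <;> module

lemma exists_eq_fromBlocks_blockFamily (i : Fin 9) :
    ∃ P ∈ Submodule.span ℝ {(1 : Matrix V V ℝ), 𝐉}, ∃ Q ∈ Submodule.span ℝ {M, 𝐉},
    ∃ R ∈ Submodule.span ℝ {Mᵀ, 𝐉}, ∃ S ∈ Submodule.span ℝ {1, X, 𝐉},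
      blockFamily M X i = Matrix.fromBlocks P Q R S := by
  have mem {W : Type} [AddCommGroup W] [Module ℝ W] {s : Set W} {w : W} (h : w ∈ s) :
    w ∈ Submodule.span ℝ s := Submodule.subset_span h
  have hI : (1 : Matrix V V ℝ) ∈ Submodule.span ℝ {(1 : Matrix V V ℝ), 𝐉} := mem (by simp)
  have hJ : (𝐉 : Matrix V V ℝ) ∈ Submodule.span ℝ {(1 : Matrix V V ℝ), 𝐉} := mem (by simp)
  have hM : M ∈ Submodule.span ℝ {M, 𝐉} := mem (by simp)
  have hMJ : 𝐉 ∈ Submodule.span ℝ {M, 𝐉} := mem (by simp)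
  have hT : Mᵀ ∈ Submodule.span ℝ {Mᵀ, 𝐉} := mem (by simp)
  have hTJ : 𝐉 ∈ Submodule.span ℝ {Mᵀ, 𝐉} := mem (by simp)
  have hXI : 1 ∈ Submodule.span ℝ {1, X, 𝐉} := mem (by simp)
  have hX : X ∈ Submodule.span ℝ {1, X, 𝐉} := mem (by simp)
  have hXJ : 𝐉 ∈ Submodule.span ℝ {1, X, 𝐉} := mem (by simp)
  fin_cases i
  · exact ⟨_, hI, _, zero_mem _, _, zero_mem _, _, zero_mem _, rfl⟩
  · exact ⟨_, sub_mem hJ hI, _, zero_mem _, _, zero_mem _, _, zero_mem _, rfl⟩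
  · exact ⟨_, zero_mem _, _, hM, _, zero_mem _, _, zero_mem _, rfl⟩
  · exact ⟨_, zero_mem _, _, sub_mem hMJ hM, _, zero_mem _, _, zero_mem _, rfl⟩
  · exact ⟨_, zero_mem _, _, zero_mem _, _, hT, _, zero_mem _, rfl⟩
  · exact ⟨_, zero_mem _, _, zero_mem _, _, sub_mem hTJ hT, _, zero_mem _, rfl⟩
  · exact ⟨_, zero_mem _, _, zero_mem _, _, zero_mem _, _, hXI, rfl⟩
  · exact ⟨_, zero_mem _, _, zero_mem _, _, zero_mem _, _, hX, rfl⟩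
  · exact ⟨_, zero_mem _, _, zero_mem _, _, zero_mem _, _, sub_mem (sub_mem hXJ hXI) hX, rfl⟩

lemma linearIndependent_blockFamily [Nontrivial V] [Nonempty B]
    (hM0 : ∃ i j, M i j = 0) (hM1 : ∃ i j, M i j = 1)
    (hXdiag : ∀ i, X i i = 0) (hX0 : ∃ i j, i ≠ j ∧ X i j = 0) (hX1 : ∃ i j, X i j = 1) :
    LinearIndependent ℝ (blockFamily M X) := by
  obtain ⟨v₁, v₂, hv⟩ := exists_pair_ne V
  obtain ⟨i₀, j₀, h₀⟩ := hM0
  obtain ⟨i₁, j₁, h₁⟩ := hM1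
  obtain ⟨a₀, b₀, hab, hx₀⟩ := hX0
  obtain ⟨a₁, b₁, hx₁⟩ := hX1
  have hab₁ : a₁ ≠ b₁ := by
    rintro rfl
    simp [hXdiag] at hx₁
  rw [Fintype.linearIndependent_iff]
  intro g hg
  have ev (p q : V ⊕ B) : ∑ i, g i * blockFamily M X i p q = 0 := by
    simpa [Matrix.sum_apply] using congrFun (congrFun hg p) q
  have e₀ := ev (.inl v₁) (.inl v₁)
  have e₁ := ev (.inl v₁) (.inl v₂)
  have e₂ := ev (.inl i₁) (.inr j₁)
  have e₃ := ev (.inl i₀) (.inr j₀)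
  have e₄ := ev (.inr j₁) (.inl i₁)
  have e₅ := ev (.inr j₀) (.inl i₀)
  have e₆ := ev (.inr a₀) (.inr a₀)
  have e₇ := ev (.inr a₁) (.inr b₁)
  have e₈ := ev (.inr a₀) (.inr b₀)
  simp [Fin.sum_univ_succ, blockFamily, hv, h₀, h₁, hab, hab₁, hx₀, hx₁, hXdiag]
    at e₀ e₁ e₂ e₃ e₄ e₅ e₆ e₇ e₈
  intro i
  fin_cases i <;> assumption

variable [Fintype V] [Fintype B]

lemma isCoherentConfig_blockFamily {k r e0 c₁ c₂ : ℝ}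
    (hM01 : ∀ i j, M i j = 0 ∨ M i j = 1)
    (hrow : ∀ i, ∑ j, M i j = r) (hcol : ∀ j, ∑ i, M i j = k)
    (hXsymm : Xᵀ = X) (hXdiag : ∀ i, X i i = 0) (hX01 : ∀ i j, X i j = 0 ∨ X i j = 1)
    (hXrow : ∀ i, ∑ j, X i j = e0)
    (hMMt : M * Mᵀ ∈ Submodule.span ℝ {1, 𝐉}) (hMtM : Mᵀ * M ∈ Submodule.span ℝ {1, X, 𝐉})
    (hXX : X * X ∈ Submodule.span ℝ {1, X, 𝐉}) (hMX : M * X = c₁ • M + c₂ • 𝐉) :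
    IsCoherentConfig (blockFamily M X) := by
  have hXt (i j) : X i j = X j i := congrFun (congrFun hXsymm j) i
  refine ⟨?_, ?_, ?_, ⟨{0, 6}, ?_⟩, ?_⟩
  · have hI {W : Type} [DecidableEq W] (i j : W) :
        (1 : Matrix W W ℝ) i j = 0 ∨ (1 : Matrix W W ℝ) i j = 1 := by
      by_cases h : i = j <;> simp [Matrix.one_apply, h]
    have hC {a : ℝ} (h : a = 0 ∨ a = 1) : 1 - a = 0 ∨ 1 - a = 1 := by
      rcases h with h | h <;> simp [h]
    have hIX (i j : B) : 1 - (1 : Matrix B B ℝ) i j - X i j = 0 ∨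
        1 - (1 : Matrix B B ℝ) i j - X i j = 1 := by
      by_cases h : i = j
      · subst h
        simp [hXdiag]
      · simpa [Matrix.one_apply, h] using hC (hX01 i j)
    intro i x y
    fin_cases i <;> rcases x with x | x <;> rcases y with y | y <;>
      first
      | exact Or.inl rfl
      | exact hI x y
      | exact hC (hI x y)
      | exact hM01 x y
      | exact hC (hM01 x y)
      | exact hM01 y x
      | exact hC (hM01 y x)
      | exact hX01 x y
      | exact hIX x y
  · simp only [Fin.sum_univ_succ, blockFamily]
    simp only [Matrix.cons_val_zero, Matrix.cons_val_succ, Fin.sum_univ_zero,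
      Matrix.fromBlocks_add, add_zero, zero_add]
    ext (i | i) (j | j) <;> simp
  · intro i
    have hcompl : (𝐉 - 1 - X)ᵀ = 𝐉 - 1 - X := by
      rw [Matrix.transpose_sub, Matrix.transpose_sub, hXsymm, Matrix.transpose_one, transpose_ones]
    refine ⟨![0, 1, 4, 5, 2, 3, 6, 7, 8] i, ?_⟩
    fin_cases i <;>
      simp [blockFamily, Matrix.fromBlocks_transpose, hXsymm, transpose_ones]
  · rw [Finset.sum_pair (by decide)]
    simp [blockFamily, Matrix.fromBlocks_add, Matrix.fromBlocks_one]
  · have hMJ {l : Type} : M * (𝐉 : Matrix B l ℝ) = r • 𝐉 := mul_ones_of_rowSum M hrow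
    have hJM {l : Type} : (𝐉 : Matrix l V ℝ) * M = k • 𝐉 := ones_mul_of_colSum M hcol
    have hTJ {l : Type} : Mᵀ * (𝐉 : Matrix V l ℝ) = k • 𝐉 := mul_ones_of_rowSum Mᵀ hcol
    have hJT {l : Type} : (𝐉 : Matrix l B ℝ) * Mᵀ = r • 𝐉 := ones_mul_of_colSum Mᵀ hrow
    have hXJ {l : Type} : X * (𝐉 : Matrix B l ℝ) = e0 • 𝐉 := mul_ones_of_rowSum X hXrow
    have hJX {l : Type} : (𝐉 : Matrix l B ℝ) * X = e0 • 𝐉 :=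
      ones_mul_of_colSum X fun j => by simp only [← hXrow j, hXt]
    have hXT : X * Mᵀ = c₁ • Mᵀ + c₂ • 𝐉 := by
      rw [← hXsymm, ← Matrix.transpose_mul, hMX, Matrix.transpose_add, Matrix.transpose_smul,
        Matrix.transpose_smul, transpose_ones]
    have hM : c₁ • M + c₂ • 𝐉 ∈ Submodule.span ℝ {M, 𝐉} :=
      Submodule.mem_span_pair.mpr ⟨c₁, c₂, rfl⟩
    have hT : c₁ • Mᵀ + c₂ • 𝐉 ∈ Submodule.span ℝ {Mᵀ, 𝐉} :=
      Submodule.mem_span_pair.mpr ⟨c₁, c₂, rfl⟩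
    intro i j
    obtain ⟨P, hP, Q, hQ, R, hR, S, hS, h⟩ :=
      exists_eq_fromBlocks_blockFamily (M := M) (X := X) i
    obtain ⟨P', hP', Q', hQ', R', hR', S', hS', h'⟩ :=
      exists_eq_fromBlocks_blockFamily (M := M) (X := X) j
    rw [h, h', Matrix.fromBlocks_multiply]
    refine fromBlocks_mem_span_blockFamily
      (add_mem (span_mul_mem ?_ hP hP') (span_mul_mem ?_ hQ hR'))
      (add_mem (span_mul_mem ?_ hP hQ') (span_mul_mem ?_ hQ hS'))
      (add_mem (span_mul_mem ?_ hR hP') (span_mul_mem ?_ hS hR'))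
      (add_mem (span_mul_mem ?_ hR hQ') (span_mul_mem ?_ hS hS'))
    all_goals
      simp only [Set.mem_insert_iff, Set.mem_singleton_iff, forall_eq_or_imp, forall_eq, one_mul,
        mul_one, Matrix.one_mul, Matrix.mul_one, hMJ, hJM, hTJ, hJT, hXJ, hJX, hMX, hXT,
        ones_mul_ones, hMMt, hMtM, hXX, hM, hT]
    all_goals
      and_intros <;>
        first
        | trivial
        | refine Submodule.smul_mem _ _ (Submodule.mem_span_of_mem ?_); simp
        | refine Submodule.mem_span_of_mem ?_; simp

lemma blockFamily_mem_span {n : ℕ} {A : Fin n → Matrix (V ⊕ B) (V ⊕ B) ℝ}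
    (hA : IsCoherentConfig A) {d d' : ℝ} (hd : d ≠ d')
    (hG : Matrix.fromBlocks (𝐉 - 1) M Mᵀ X ∈ Submodule.span ℝ (Set.range A))
    (hrowV : ∀ i, ∑ j, (𝐉 - 1 : Matrix V V ℝ) i j + ∑ j, M i j = d)
    (hrowB : ∀ i, ∑ j, Mᵀ i j + ∑ j, X i j = d') (i : Fin 9) :
    blockFamily M X i ∈ Submodule.span ℝ (Set.range A) := by
  set S := Submodule.span ℝ (Set.range A) with hS
  have hI : Matrix.fromBlocks 1 0 0 1 ∈ S := by
    rw [Matrix.fromBlocks_one]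
    exact hA.one_mem_s10
  have hJ : Matrix.fromBlocks 𝐉 𝐉 𝐉 𝐉 ∈ S := by
    convert hA.ones_mem using 1
    ext (i | i) (j | j) <;> rfl
  have hD : Matrix.fromBlocks (d • 1) 0 0 (d' • 1) ∈ S := by
    convert hA.hadamard_mem (hA.mul_mem_s10 hG hJ) hI using 1
    rw [Matrix.fromBlocks_multiply]
    ext (i | i) (j | j)
    · by_cases h : i = j <;> simp [Matrix.mul_apply, ← hrowV i, Matrix.one_apply, h]
    · simp
    · simp
    · by_cases h : i = j <;> simp [Matrix.mul_apply, ← hrowB i, h]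
  have sub {P P' : Matrix V V ℝ} {Q Q' : Matrix V B ℝ} {R R' : Matrix B V ℝ} {T T' : Matrix B B ℝ}
      (h : Matrix.fromBlocks P Q R T ∈ S) (h' : Matrix.fromBlocks P' Q' R' T' ∈ S) :
      Matrix.fromBlocks (P - P') (Q - Q') (R - R') (T - T') ∈ S := by
    convert S.sub_mem h h' using 1
    ext (i | i) (j | j) <;> rfl
  have hE : Matrix.fromBlocks (1 : Matrix V V ℝ) 0 0 (0 : Matrix B B ℝ) ∈ S := by
    have h := S.smul_mem d' hI
    rw [Matrix.fromBlocks_smul] at h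
    have h' := S.smul_mem (d - d')⁻¹ (sub hD h)
    rwa [Matrix.fromBlocks_smul, ← sub_smul, smul_smul, inv_mul_cancel₀ (sub_ne_zero.mpr hd),
      one_smul, sub_self, smul_zero, smul_zero, smul_zero, sub_zero, sub_zero, smul_zero,
      smul_zero] at h'
  have hF : Matrix.fromBlocks (0 : Matrix V V ℝ) 0 0 (1 : Matrix B B ℝ) ∈ S := by
    simpa using sub hI hE
  have block {P : Matrix V V ℝ} {Q : Matrix V B ℝ} {R : Matrix B V ℝ} {T : Matrix B B ℝ}
      (h : Matrix.fromBlocks P Q R T ∈ S) :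
      Matrix.fromBlocks P 0 0 0 ∈ S ∧ Matrix.fromBlocks 0 Q 0 0 ∈ S ∧
      Matrix.fromBlocks 0 0 R 0 ∈ S ∧ Matrix.fromBlocks 0 0 0 T ∈ S := by
    refine ⟨?_, ?_, ?_, ?_⟩
    · simpa [Matrix.fromBlocks_multiply] using hA.mul_mem_s10 (hA.mul_mem_s10 hE h) hE
    · simpa [Matrix.fromBlocks_multiply] using hA.mul_mem_s10 (hA.mul_mem_s10 hE h) hF
    · simpa [Matrix.fromBlocks_multiply] using hA.mul_mem_s10 (hA.mul_mem_s10 hF h) hE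
    · simpa [Matrix.fromBlocks_multiply] using hA.mul_mem_s10 (hA.mul_mem_s10 hF h) hF
  have hGb := block hG
  have hC := block (sub (sub hJ hI) hG)
  have hC' := block (sub hJ hG)
  fin_cases i
  · exact hE
  · exact hGb.1
  · exact hGb.2.1
  · exact hC'.2.1
  · exact hGb.2.2.1
  · exact hC'.2.2.1
  · exact hF
  · exact hGb.2.2.2
  · exact hC.2.2.2

end BlockFamily

section BlockAdjacency

variable {V B : Type} [Fintype V] [Fintype B] [DecidableEq V]
  {M : Matrix V B ℝ} {X : Matrix B B ℝ} {k r lam x y e0 e1 e2 s p t : ℝ}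

lemma blockAdj_mulVec_const (hrow : ∀ i, ∑ j, M i j = r) (hcol : ∀ j, ∑ i, M i j = k)
    (hXrow : ∀ i, ∑ j, X i j = e0) (α β : ℝ) :
    Matrix.fromBlocks (𝐉 - 1) M Mᵀ X *ᵥ Sum.elim (fun _ => α) (fun _ => β)
      = Sum.elim (fun _ => (Fintype.card V - 1) * α + r * β) (fun _ => k * α + e0 * β) := by
  rw [Matrix.fromBlocks_mulVec, ← Sum.elim_comp_inl_inr (Sum.elim _ _ : V ⊕ B → ℝ)]
  congr 1
  · ext i
    simp [Matrix.sub_mulVec, Matrix.mulVec, dotProduct, ← Finset.sum_mul, hrow, sub_mul]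
  · ext i
    simp [Matrix.mulVec, dotProduct, ← Finset.sum_mul, hcol, hXrow]

variable [DecidableEq B]

lemma mul_eq_of_quasiSymmetric (hrow : ∀ i, ∑ j, M i j = r) (hcol : ∀ j, ∑ i, M i j = k)
    (hMMt : M * Mᵀ = (r - lam) • 1 + lam • 𝐉)
    (hMtM : Mᵀ * M = k • 1 + x • X + y • (𝐉 - 1 - X)) (hxy : x - y ≠ 0) :
    M * X = ((r - lam + y - k) / (x - y)) • M + ((lam * k - y * r) / (x - y)) • 𝐉 := by
  have h : (x - y) • (M * X) = (r - lam + y - k) • M + (lam * k - y * r) • 𝐉 := by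
    have h := Matrix.mul_assoc M Mᵀ M
    rw [hMMt, hMtM] at h
    simp only [Matrix.add_mul, Matrix.mul_add, Matrix.mul_sub, Matrix.smul_mul, Matrix.mul_smul,
      Matrix.one_mul, Matrix.mul_one, mul_ones_of_rowSum M hrow, ones_mul_of_colSum M hcol] at h
    rw [← sub_eq_zero] at h ⊢
    rw [← neg_eq_zero, ← h]
    module
  rw [← inv_smul_smul₀ hxy (M * X), h, smul_add, smul_smul, smul_smul, inv_mul_eq_div,
    inv_mul_eq_div]

lemma blockAdj_mul_self (hXsymm : Xᵀ = X) (hcol : ∀ j, ∑ i, M i j = k)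
    (hMMt : M * Mᵀ = (r - lam) • 1 + lam • 𝐉)
    (hMtM : Mᵀ * M = k • 1 + x • X + y • (𝐉 - 1 - X))
    (hXX : X * X = (e1 + e2) • X - (e1 * e2) • 1 + (e0 + e1 * e2) • 𝐉)
    (hMX : M * X = (s + 1) • M + t • 𝐉) (hl : lam = r + p + s + 1)
    (hx : x = k + p + s - e1 * e2 - e1 - e2) (hy : y = k + p - e1 * e2) :
    Matrix.fromBlocks (𝐉 - 1) M Mᵀ X * Matrix.fromBlocks (𝐉 - 1) M Mᵀ X
      = s • Matrix.fromBlocks (𝐉 - 1) M Mᵀ X + -p • 1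
        + Matrix.fromBlocks ((Fintype.card V - 1 + r + p : ℝ) • 𝐉) ((k + t) • 𝐉) ((k + t) • 𝐉)
          ((k + e0 + p) • 𝐉) := by
  have hXT : X * Mᵀ = (s + 1) • Mᵀ + t • 𝐉 := by
    rw [← hXsymm, ← Matrix.transpose_mul, hMX, Matrix.transpose_add, Matrix.transpose_smul,
      Matrix.transpose_smul, transpose_ones]
  have hTJ : Mᵀ * (𝐉 : Matrix V V ℝ) = k • 𝐉 := mul_ones_of_rowSum Mᵀ hcol
  rw [← Matrix.fromBlocks_one, Matrix.fromBlocks_smul, Matrix.fromBlocks_smul, Matrix.fromBlocks_add, Matrix.fromBlocks_add,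
    Matrix.fromBlocks_multiply]
  congr 1
  · rw [hMMt, sub_mul, mul_sub, mul_sub, ones_mul_ones, hl]
    simp only [one_mul, mul_one]
    module
  · rw [hMX, Matrix.sub_mul, ones_mul_of_colSum M hcol, Matrix.one_mul]
    module
  · rw [hXT, Matrix.mul_sub, hTJ, Matrix.mul_one]
    module
  · rw [hMtM, hXX, hx, hy]
    module

variable {A : Matrix (V ⊕ B) (V ⊕ B) ℝ} {θ1 θ2 a w c : ℝ}

lemma mulVec_mulVec_of_mul_self
    (hA : A * A = (θ1 + θ2) • A + -(θ1 * θ2) • 1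
      + Matrix.fromBlocks (a • 𝐉) (w • 𝐉) (w • 𝐉) (c • 𝐉)) (f : V ⊕ B → ℝ) :
    A *ᵥ (A *ᵥ f) = (θ1 + θ2) • A *ᵥ f + -(θ1 * θ2) • f
      + Sum.elim (fun _ => a * ∑ i, f (Sum.inl i) + w * ∑ i, f (Sum.inr i))
        (fun _ => w * ∑ i, f (Sum.inl i) + c * ∑ i, f (Sum.inr i)) := by
  rw [Matrix.mulVec_mulVec, hA, Matrix.add_mulVec, Matrix.add_mulVec, Matrix.smul_mulVec,
    Matrix.smul_mulVec, Matrix.one_mulVec, Matrix.fromBlocks_mulVec]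
  congr 2 <;> ext i <;> simp [Matrix.mulVec, dotProduct, Finset.mul_sum]

lemma eq_elim_const_of_mulVec_eq_smul
    (hA : A * A = (θ1 + θ2) • A + -(θ1 * θ2) • 1
      + Matrix.fromBlocks (a • 𝐉) (w • 𝐉) (w • 𝐉) (c • 𝐉)) {f : V ⊕ B → ℝ} {θ : ℝ}
    (hf : A *ᵥ f = θ • f) (h1 : θ ≠ θ1) (h2 : θ ≠ θ2) :
    ∃ α β : ℝ, f = Sum.elim (fun _ => α) (fun _ => β) := by
  have h := mulVec_mulVec_of_mul_self hA f
  rw [hf, Matrix.mulVec_smul, hf] at h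
  have hθ : (θ - θ1) * (θ - θ2) ≠ 0 := mul_ne_zero (sub_ne_zero.mpr h1) (sub_ne_zero.mpr h2)
  refine ⟨(a * ∑ i, f (Sum.inl i) + w * ∑ i, f (Sum.inr i)) / ((θ - θ1) * (θ - θ2)),
    (w * ∑ i, f (Sum.inl i) + c * ∑ i, f (Sum.inr i)) / ((θ - θ1) * (θ - θ2)), ?_⟩
  ext i
  have hi := congrFun h i
  rcases i with i | i <;>
  · simp only [Pi.add_apply, Pi.smul_apply, smul_eq_mul, Sum.elim_inl, Sum.elim_inr] at hi ⊢
    rw [eq_div_iff hθ]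
    linear_combination hi

lemma exists_mulVec_eq_smul_of_mul_self
    (hA : Matrix.fromBlocks (𝐉 - 1) M Mᵀ X * Matrix.fromBlocks (𝐉 - 1) M Mᵀ X
      = (θ1 + θ2) • Matrix.fromBlocks (𝐉 - 1) M Mᵀ X + -(θ1 * θ2) • 1
        + Matrix.fromBlocks (a • 𝐉) (w • 𝐉) (w • 𝐉) (c • 𝐉)) (hθ2 : θ2 ≠ -1)
    {g : V → ℝ} (hg : g ≠ 0) (hg0 : ∑ i, g i = 0) :
    ∃ f : V ⊕ B → ℝ, f ≠ 0 ∧ Matrix.fromBlocks (𝐉 - 1) M Mᵀ X *ᵥ f = θ1 • f := by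
  set f : V ⊕ B → ℝ := Sum.elim g 0 with hf
  have h := mulVec_mulVec_of_mul_self hA f
  set A := Matrix.fromBlocks (𝐉 - 1) M Mᵀ X with hA'
  refine ⟨A *ᵥ f - θ2 • f, fun h0 => hg ?_, ?_⟩
  · ext i
    have hi := congrFun h0 (Sum.inl i)
    simp [hA', hf, Matrix.fromBlocks_mulVec, Matrix.sub_mulVec, Matrix.mulVec, dotProduct,
      hg0] at hi
    have : (θ2 + 1) * g i = 0 := by linear_combination -hi
    exact (mul_eq_zero.mp this).resolve_left fun h => hθ2 (by linear_combination h)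
  · rw [Matrix.mulVec_sub, Matrix.mulVec_smul, h]
    ext (i | i) <;> simp [hf, hg0] <;> ring

lemma blockAdj_param_of_mul_self [Nonempty V] [Nonempty B]
    (hA : Matrix.fromBlocks (𝐉 - 1) M Mᵀ X * Matrix.fromBlocks (𝐉 - 1) M Mᵀ X
      = (θ1 + θ2) • Matrix.fromBlocks (𝐉 - 1) M Mᵀ X + -(θ1 * θ2) • 1
        + Matrix.fromBlocks (a • 𝐉) (w • 𝐉) (w • 𝐉) (c • 𝐉))
    (hrow : ∀ i, ∑ j, M i j = r) (hcol : ∀ j, ∑ i, M i j = k) (hXrow : ∀ i, ∑ j, X i j = e0) :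
    a * Fintype.card V = (Fintype.card V - 1 : ℝ) ^ 2 + r * k - (θ1 + θ2) * (Fintype.card V - 1)
        + θ1 * θ2 ∧
      w * Fintype.card V = k * (Fintype.card V - 1 + e0 - (θ1 + θ2)) ∧
      w * Fintype.card B = r * (Fintype.card V - 1 + e0 - (θ1 + θ2)) ∧
      c * Fintype.card B = e0 ^ 2 + r * k - (θ1 + θ2) * e0 + θ1 * θ2 := by
  have key (α β : ℝ) := mulVec_mulVec_of_mul_self hA (Sum.elim (fun _ => α) (fun _ => β))
  simp only [blockAdj_mulVec_const hrow hcol hXrow] at key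
  let i : V := Classical.arbitrary V
  let j : B := Classical.arbitrary B
  have h1 := congrFun (key 1 0) (Sum.inl i)
  have h2 := congrFun (key 1 0) (Sum.inr j)
  have h3 := congrFun (key 0 1) (Sum.inl i)
  have h4 := congrFun (key 0 1) (Sum.inr j)
  simp at h1 h2 h3 h4
  exact ⟨by linear_combination -h1, by linear_combination -h2, by linear_combination -h3,
    by linear_combination -h4⟩

lemma blockAdj_eigs [Nontrivial V] [Nonempty B]
    (hA : Matrix.fromBlocks (𝐉 - 1) M Mᵀ X * Matrix.fromBlocks (𝐉 - 1) M Mᵀ X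
      = (θ1 + θ2) • Matrix.fromBlocks (𝐉 - 1) M Mᵀ X + -(θ1 * θ2) • 1
        + Matrix.fromBlocks (a • 𝐉) (w • 𝐉) (w • 𝐉) (c • 𝐉))
    (hrow : ∀ i, ∑ j, M i j = r) (hcol : ∀ j, ∑ i, M i j = k) (hXrow : ∀ i, ∑ j, X i j = e0)
    (hr : r ≠ 0) (h1 : θ1 ≠ -1) (h2 : θ2 ≠ -1) (hac : w ^ 2 = a * c) {θ0 : ℝ}
    (hθ0 : (θ0 - (Fintype.card V - 1)) * (θ0 - e0) = r * k) (h01 : θ0 ≠ θ1) (h02 : θ0 ≠ θ2) :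
    {θ : ℝ | ∃ f : V ⊕ B → ℝ, f ≠ 0 ∧ Matrix.fromBlocks (𝐉 - 1) M Mᵀ X *ᵥ f = θ • f}
      = {θ0, θ1, θ2} := by
  obtain ⟨ha, hw, hw', hc⟩ := blockAdj_param_of_mul_self hA hrow hcol hXrow
  set n : ℝ := (Fintype.card V : ℝ)
  have hfactor (θ : ℝ) : (θ - (n - 1)) * (θ - e0) - r * k
      = (θ - θ0) * (θ - (n - 1 + e0 - θ0)) := by linear_combination hθ0
  have hprod : ((θ1 - (n - 1)) * (θ1 - e0) - r * k) * ((θ2 - (n - 1)) * (θ2 - e0) - r * k) = 0 := by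
    have : (w * n) * (w * Fintype.card B) = (a * n) * (c * Fintype.card B) := by
      linear_combination n * Fintype.card B * hac
    rw [ha, hw, hw', hc] at this
    linear_combination -this
  have hμ : n - 1 + e0 - θ0 = θ1 ∨ n - 1 + e0 - θ0 = θ2 := by
    rw [hfactor, hfactor] at hprod
    rcases mul_eq_zero.mp hprod with h | h
    · exact Or.inl (sub_eq_zero.mp ((mul_eq_zero.mp h).resolve_left
        (sub_ne_zero.mpr h01.symm))).symm
    · exact Or.inr (sub_eq_zero.mp ((mul_eq_zero.mp h).resolve_left
        (sub_ne_zero.mpr h02.symm))).symm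
  obtain ⟨g, hg, hg0⟩ : ∃ g : V → ℝ, g ≠ 0 ∧ ∑ i, g i = 0 := by
    obtain ⟨i, j, hij⟩ := exists_pair_ne V
    refine ⟨Pi.single i 1 - Pi.single j 1, fun h => ?_, by simp⟩
    simpa [hij] using congrFun h i
  ext θ
  simp only [Set.mem_ofPred_eq, Set.mem_insert_iff, Set.mem_singleton_iff]
  constructor
  · rintro ⟨f, hf0, hf⟩
    by_contra! hθ
    obtain ⟨α, β, rfl⟩ := eq_elim_const_of_mulVec_eq_smul hA hf hθ.2.1 hθ.2.2
    rw [blockAdj_mulVec_const hrow hcol hXrow] at hf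
    have hα := congrFun hf (Sum.inl (Classical.arbitrary V))
    have hβ := congrFun hf (Sum.inr (Classical.arbitrary B))
    simp only [Sum.elim_inl, Sum.elim_inr, Pi.smul_apply, smul_eq_mul] at hα hβ
    have hα' : ((θ - (n - 1)) * (θ - e0) - r * k) * α = 0 := by
      linear_combination -(θ - e0) * hα - r * hβ
    have hβ' : ((θ - (n - 1)) * (θ - e0) - r * k) * β = 0 := by
      linear_combination -(θ - (n - 1)) * hβ - k * hα
    have hq : (θ - (n - 1)) * (θ - e0) - r * k ≠ 0 := by
      rw [hfactor]
      refine mul_ne_zero (sub_ne_zero.mpr hθ.1) (sub_ne_zero.mpr ?_)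
      rcases hμ with h | h <;> rw [h]
      exacts [hθ.2.1, hθ.2.2]
    refine hf0 ?_
    rw [(mul_eq_zero.mp hα').resolve_left hq, (mul_eq_zero.mp hβ').resolve_left hq]
    ext (i | i) <;> rfl
  · rintro (rfl | rfl | rfl)
    · refine ⟨Sum.elim (fun _ => r) (fun _ => θ - (n - 1)), fun h =>
        hr (congrFun h (Sum.inl (Classical.arbitrary V))), ?_⟩
      rw [blockAdj_mulVec_const hrow hcol hXrow]
      ext (i | i) <;> simp only [Sum.elim_inl, Sum.elim_inr, Pi.smul_apply, smul_eq_mul]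
      · ring
      · linear_combination -hθ0
    · exact exists_mulVec_eq_smul_of_mul_self hA h2 hg hg0
    · rw [add_comm θ1, mul_comm θ1] at hA
      exact exists_mulVec_eq_smul_of_mul_self hA h1 hg hg0

end BlockAdjacency

section BlockGraph

variable {V B : Type} [DecidableEq V]
  {M : Matrix V B ℝ} {X : Matrix B B ℝ}

lemma connected_of_blockAdj [Nonempty V] (hM1 : ∀ j, ∃ i, M i j = 1) (G : SimpleGraph (V ⊕ B))
    [DecidableRel G.Adj] (hG : G.adjMatrix ℝ = Matrix.fromBlocks (𝐉 - 1) M Mᵀ X) :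
    G.Connected := by
  have hadj {u u'} (h : Matrix.fromBlocks (𝐉 - 1) M Mᵀ X u u' = 1) : G.Adj u u' := by
    by_contra h'
    rw [← hG, SimpleGraph.adjMatrix_apply, if_neg h'] at h
    exact zero_ne_one h
  have hV (i i' : V) : G.Reachable (Sum.inl i) (Sum.inl i') := by
    by_cases h : i = i'
    · rw [h]
    · exact (hadj (by simp [h])).reachable
  have hto (u : V ⊕ B) : G.Reachable (Sum.inl (Classical.arbitrary V)) u := by
    rcases u with i | j
    · exact hV _ i
    · obtain ⟨i, hi⟩ := hM1 j
      exact (hV _ i).trans (hadj (by simpa using hi)).reachable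
  exact { preconnected := fun u u' => (hto u).symm.trans (hto u')
          nonempty := ⟨Sum.inl (Classical.arbitrary V)⟩ }

variable [Fintype V] [Fintype B] [DecidableEq B]

lemma hasCoherentRank_nine_of_blockFamily (hcc : IsCoherentConfig (blockFamily M X))
    (hli : LinearIndependent ℝ (blockFamily M X)) {d d' : ℝ} (hd : d ≠ d')
    (hrowV : ∀ i, ∑ j, (𝐉 - 1 : Matrix V V ℝ) i j + ∑ j, M i j = d)
    (hrowB : ∀ i, ∑ j, Mᵀ i j + ∑ j, X i j = d') (G : SimpleGraph (V ⊕ B))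
    [DecidableRel G.Adj] (hG : G.adjMatrix ℝ = Matrix.fromBlocks (𝐉 - 1) M Mᵀ X) :
    HasCoherentRank G 9 := by
  refine ⟨⟨blockFamily M X, hcc, ?_⟩, ?_⟩
  · rw [hG]
    exact fromBlocks_mem_span_blockFamily
      (sub_mem (Submodule.mem_span_of_mem (by simp)) (Submodule.mem_span_of_mem (by simp)))
      (Submodule.mem_span_of_mem (by simp)) (Submodule.mem_span_of_mem (by simp))
      (Submodule.mem_span_of_mem (by simp))
  · rintro n ⟨A, hA, hGA⟩
    rw [hG] at hGA
    have h := linearIndependent_le_span_aux' (blockFamily M X) hli (Set.range A) <| by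
      rintro _ ⟨i, rfl⟩
      exact blockFamily_mem_span hA hd hGA hrowV hrowB i
    have h' := Fintype.card_range_le A
    simp only [Fintype.card_fin] at h h'
    exact h.trans h'

lemma exists_adjMatrix_ne_of_eigs (H : SimpleGraph B) [DecidableRel H.Adj] {d e e' : ℝ}
    (hd : ∀ i, ∑ j, H.adjMatrix ℝ i j = d) (he : adjEig H e) (he' : adjEig H e') (hed : e ≠ d)
    (hed' : e' ≠ d) (hee' : e ≠ e') (c : ℝ) : ∃ i j, i ≠ j ∧ H.adjMatrix ℝ i j ≠ c := by
  by_contra! h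
  have hH : H.adjMatrix ℝ = c • (𝐉 - 1) := by
    ext i j
    by_cases hij : i = j
    · simp [hij]
    · simpa [Matrix.one_apply, hij] using h i j hij
  have key {e : ℝ} (he : adjEig H e) (hed : e ≠ d) : e = -c := by
    obtain ⟨f, hf, hfe⟩ := he
    have hsum := sum_eq_zero_of_mulVec_eq_smul H hd hed hfe
    obtain ⟨i, hi⟩ := Function.ne_iff.mp hf
    have hi' := congrFun hfe i
    rw [hH, Matrix.smul_mulVec, Matrix.sub_mulVec, Matrix.one_mulVec] at hi'
    simp [Matrix.mulVec, dotProduct, hsum] at hi'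
    exact mul_right_cancel₀ hi (by linear_combination -hi')
  exact hee' ((key he hed).trans (key he' hed').symm)

lemma adjEig_of_mul_transpose [Nontrivial V] (H : SimpleGraph B) [DecidableRel H.Adj]
    {μ lam c t : ℝ} (hMMt : M * Mᵀ = μ • 1 + lam • 𝐉) (hμ : μ ≠ 0)
    (hHM : H.adjMatrix ℝ * Mᵀ = c • Mᵀ + t • 𝐉) : adjEig H c := by
  obtain ⟨i, j, hij⟩ := exists_pair_ne V
  set g : V → ℝ := Pi.single i 1 - Pi.single j 1 with hg
  have hJg {l : Type} : (𝐉 : Matrix l V ℝ) *ᵥ g = 0 := by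
    ext
    simp [hg, Matrix.mulVec, dotProduct]
  refine ⟨Mᵀ *ᵥ g, fun h => ?_, ?_⟩
  · have h' := Matrix.mulVec_mulVec g M Mᵀ
    rw [h, hMMt, Matrix.add_mulVec, Matrix.smul_mulVec, Matrix.smul_mulVec, hJg,
      Matrix.one_mulVec, Matrix.mulVec_zero] at h'
    simpa [hg, hij, hμ.symm] using congrFun h' i
  · rw [Matrix.mulVec_mulVec, hHM, Matrix.add_mulVec, Matrix.smul_mulVec, Matrix.smul_mulVec, hJg,
      smul_zero, add_zero]

end BlockGraph

/-- Converse construction for coherent rank 9, whole-graph case: under the stated parameter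
identities, the graph with block adjacency matrix `[[J-I, M],[Mᵀ, X]]` is connected with
eigenvalue set exactly `{θ0, θ1, θ2}` where
`θ0 = (v - 1 + e0 + √((v - 1 - e0)² + 4rk))/2`, and if `v - 1 + r ≠ k + e0` it has
coherent rank `9`. -/
theorem stmt10 (θ1 θ2 : ℤ) (hθ1 : 1 ≤ θ1) (hθ2 : θ2 ≤ -2)
    (v b k r lam : ℕ) (hv : 0 < v) (hb : 0 < b) (hk : 0 < k) (hr : 0 < r) (hlam : 0 < lam)
    (x y : ℤ) (hxy : x ≠ y)
    (M : Matrix (Fin v) (Fin b) ℝ)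
    (hM01 : ∀ i j, M i j = 0 ∨ M i j = 1)
    (hrow : ∀ i, ∑ j, M i j = (r : ℝ))
    (hcol : ∀ j, ∑ i, M i j = (k : ℝ))
    (hMMt : M * Mᵀ = ((r : ℝ) - lam) • (1 : Matrix (Fin v) (Fin v) ℝ)
      + (lam : ℝ) • Matrix.of (fun _ _ => 1))
    (X : Matrix (Fin b) (Fin b) ℝ)
    (hXsymm : Xᵀ = X) (hXdiag : ∀ i, X i i = 0) (hX01 : ∀ i j, X i j = 0 ∨ X i j = 1)
    (hMtM : Mᵀ * M = (k : ℝ) • (1 : Matrix (Fin b) (Fin b) ℝ) + (x : ℝ) • X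
      + (y : ℝ) • (Matrix.of (fun _ _ => 1) - (1 : Matrix (Fin b) (Fin b) ℝ) - X))
    (H : SimpleGraph (Fin b)) [DecidableRel H.Adj]
    (hH : SimpleGraph.adjMatrix ℝ H = X)
    (hHconn : H.Connected)
    (e0 e1 e2 : ℝ) (he01 : e1 < e0) (he12 : e2 < e1)
    (hHeig : {θ : ℝ | adjEig H θ} = {e0, e1, e2})
    (hx : (x : ℝ) = (k : ℝ) + ((θ1 : ℝ) + 1) * ((θ2 : ℝ) + 1) - (e1 + 1) * (e2 + 1))
    (hy : (y : ℝ) = (k : ℝ) + (θ1 : ℝ) * (θ2 : ℝ) - e1 * e2)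
    (hl : (lam : ℝ) = (r : ℝ) + ((θ1 : ℝ) + 1) * ((θ2 : ℝ) + 1))
    (hratio : ((r : ℝ) - (lam : ℝ) + (y : ℝ) - (k : ℝ)) / ((x : ℝ) - (y : ℝ))
      = (θ1 : ℝ) + (θ2 : ℝ) + 1)
    (hsqrt : (k : ℝ) + ((lam : ℝ) * (k : ℝ) - (y : ℝ) * (r : ℝ)) / ((x : ℝ) - (y : ℝ))
      = Real.sqrt (((v : ℝ) - 1 + (r : ℝ) + (θ1 : ℝ) * (θ2 : ℝ))
          * ((k : ℝ) + e0 + (θ1 : ℝ) * (θ2 : ℝ)))) :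
    ∀ (G : SimpleGraph (Fin v ⊕ Fin b)) [DecidableRel G.Adj],
      SimpleGraph.adjMatrix ℝ G
        = Matrix.fromBlocks (Matrix.of (fun _ _ => 1) - (1 : Matrix (Fin v) (Fin v) ℝ))
            M Mᵀ X →
      G.Connected ∧
      {θ : ℝ | adjEig G θ}
        = {((v : ℝ) - 1 + e0 + Real.sqrt (((v : ℝ) - 1 - e0) ^ 2 + 4 * (r : ℝ) * (k : ℝ))) / 2,
            (θ1 : ℝ), (θ2 : ℝ)} ∧
      ((v : ℝ) - 1 + (r : ℝ) ≠ (k : ℝ) + e0 → HasCoherentRank G 9) := by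
  intro G _ hG
  have : NeZero v := ⟨hv.ne'⟩
  have : NeZero b := ⟨hb.ne'⟩
  have hv' : (0 : ℝ) < v := Nat.cast_pos.mpr hv
  have hb' : (0 : ℝ) < b := Nat.cast_pos.mpr hb
  have hk' : (1 : ℝ) ≤ k := Nat.one_le_cast.mpr hk
  have hr' : (0 : ℝ) < r := Nat.cast_pos.mpr hr
  have hlam' : (0 : ℝ) < lam := Nat.cast_pos.mpr hlam
  have hθ1' : (1 : ℝ) ≤ θ1 := by exact_mod_cast hθ1
  have hθ2' : (θ2 : ℝ) ≤ -2 := by exact_mod_cast hθ2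
  have hxy' : (x : ℝ) - y ≠ 0 := sub_ne_zero.mpr (Int.cast_injective.ne hxy)
  -- The strongly regular graph `H` has valency `e0`.
  have hXrow : ∀ i, ∑ j, X i j = e0 := by
    obtain ⟨d, hd⟩ : ∃ d : ℝ, ∀ i, ∑ j, X i j = d := by
      refine ⟨(r * k - k + y - y * b) / (x - y), fun i => ?_⟩
      have h1 : Mᵀ * (M * (𝐉 : Matrix (Fin b) (Fin b) ℝ)) = (r * k : ℝ) • 𝐉 := by
        rw [mul_ones_of_rowSum M hrow, Matrix.mul_smul, mul_ones_of_rowSum Mᵀ hcol, smul_smul]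
      rw [← Matrix.mul_assoc, hMtM] at h1
      simp only [Matrix.add_mul, Matrix.sub_mul, Matrix.smul_mul, Matrix.one_mul,
        ones_mul_ones] at h1
      have h2 := congrFun (congrFun h1 i) i
      simp [Matrix.mul_apply] at h2
      rw [eq_div_iff hxy']
      linear_combination h2
    have hdH : ∀ i, ∑ j, H.adjMatrix ℝ i j = d := by rwa [hH]
    have hd0 : d ∈ ({e0, e1, e2} : Set ℝ) := hHeig ▸ adjEig_of_rowSum H hdH
    have hle : e0 ≤ d := le_of_adjEig_of_rowSum H hdH (hHeig.ge (by simp))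
    rcases hd0 with h | h | h
    · exact h ▸ hd
    · linarith [show d = e1 from h]
    · linarith [show d = e2 from h]
  have hHrow : ∀ i, ∑ j, H.adjMatrix ℝ i j = e0 := by rwa [hH]
  have he1 : adjEig H e1 := hHeig.ge (by simp)
  have he2 : adjEig H e2 := hHeig.ge (by simp)
  have hXX : X * X = (e1 + e2) • X - (e1 * e2) • 1 + (e0 + e1 * e2) • 𝐉 :=
    hH ▸ adjMatrix_mul_self_of_eigs H hHconn hHrow hHeig
  set t : ℝ := (lam * k - y * r) / (x - y) with ht
  have hMX : M * X = ((θ1 : ℝ) + θ2 + 1) • M + t • 𝐉 := by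
    rw [mul_eq_of_quasiSymmetric hrow hcol hMMt hMtM hxy', hratio]
  have hA := blockAdj_mul_self (s := (θ1 : ℝ) + θ2) (p := (θ1 : ℝ) * θ2) hXsymm hcol hMMt hMtM hXX
    hMX (by linear_combination hl) (by linear_combination hx) hy
  have hXoff := exists_adjMatrix_ne_of_eigs H hHrow he1 he2 he01.ne (he12.trans he01).ne he12.ne'
  rw [hH] at hXoff
  have : Nontrivial (Fin v) := by
    by_contra hsub
    rw [not_nontrivial_iff_subsingleton] at hsub
    have hM (i j) : M i j = 1 := by
      refine (hM01 i j).resolve_left fun h => ?_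
      have := hcol j
      rw [Fintype.sum_subsingleton _ i, h] at this
      linarith
    obtain ⟨i, j, hij, hne⟩ := hXoff ((1 - y) / (x - y))
    refine hne ?_
    have h := congrFun (congrFun hMtM i) j
    have hv1 : v = 1 := (Fin.subsingleton_iff_le_one.mp hsub).antisymm hv
    simp [Matrix.mul_apply, hM, hij, hv1] at h
    rw [eq_div_iff hxy']
    linear_combination -h
  -- The geometric mean condition on the quotient.
  have hac : ((k : ℝ) + t) ^ 2
      = (Fintype.card (Fin v) - 1 + r + (θ1 : ℝ) * θ2) * (k + e0 + (θ1 : ℝ) * θ2) := by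
    obtain ⟨ha, hw, -, hc⟩ := blockAdj_param_of_mul_self hA hrow hcol hXrow
    simp only [Fintype.card_fin] at ha hw hc ⊢
    set a : ℝ := v - 1 + r + (θ1 : ℝ) * θ2
    set c : ℝ := k + e0 + (θ1 : ℝ) * θ2
    rw [hsqrt]
    refine Real.sq_sqrt (le_of_not_gt fun hneg => hneg.not_ge ?_)
    rw [hsqrt, Real.sqrt_eq_zero_of_nonpos hneg.le, zero_mul] at hw
    have hs : (v : ℝ) - 1 + e0 - (θ1 + θ2) = 0 :=
      (mul_eq_zero.mp hw.symm).resolve_left (by linarith)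
    have hac : a * v = c * b := by
      rw [ha, hc]
      linear_combination ((v : ℝ) - 1 - e0) * hs
    have hsq : a * c * (v * b) = (a * v) ^ 2 := by linear_combination a * v * -hac
    exact le_of_mul_le_mul_right (by rw [hsq, zero_mul]; positivity) (mul_pos hv' hb')
  have hv1 : (1 : ℝ) ≤ v := Nat.one_le_cast.mpr hv
  have hrl : (r : ℝ) - lam = -((θ1 + 1) * (θ2 + 1)) := by linear_combination -hl
  have hrl0 : (r : ℝ) - lam ≠ 0 := by nlinarith
  set θ0 : ℝ := ((v : ℝ) - 1 + e0 + √(((v : ℝ) - 1 - e0) ^ 2 + 4 * r * k)) / 2 with hθ0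
  have hrk : (r : ℝ) ≤ r * k := le_mul_of_one_le_right hr'.le hk'
  have hsqrt_sq := Real.sq_sqrt (show 0 ≤ ((v : ℝ) - 1 - e0) ^ 2 + 4 * r * k by positivity)
  have hsqrt_gt : |(v : ℝ) - 1 - e0| < √(((v : ℝ) - 1 - e0) ^ 2 + 4 * r * k) :=
    Real.lt_sqrt_of_sq_lt (by rw [sq_abs]; nlinarith)
  have hθ0e : e0 < θ0 := by linarith [neg_abs_le ((v : ℝ) - 1 - e0)]
  have hθ0v : (v : ℝ) - 1 < θ0 := by linarith [le_abs_self ((v : ℝ) - 1 - e0)]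
  have hq : (θ0 - (v - 1)) * (θ0 - e0) = r * k := by
    rw [hθ0]
    linear_combination hsqrt_sq / 4
  have h01 : θ0 ≠ θ1 := by
    intro h
    have hXT : H.adjMatrix ℝ * Mᵀ = ((θ1 : ℝ) + θ2 + 1) • Mᵀ + t • 𝐉 := by
      rw [hH, ← hXsymm, ← Matrix.transpose_mul, hMX, Matrix.transpose_add, Matrix.transpose_smul,
        Matrix.transpose_smul, transpose_ones]
    have hle := le_of_adjEig_of_rowSum H hHrow (adjEig_of_mul_transpose H hMMt hrl0 hXT)
    rw [h] at hq hθ0e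
    nlinarith
  have hM1 (j) : ∃ i, M i j = 1 := by
    by_contra! h
    have := hcol j
    rw [Finset.sum_eq_zero fun i _ => (hM01 i j).resolve_right (h i)] at this
    linarith
  refine ⟨connected_of_blockAdj hM1 G hG, ?_, fun hne => ?_⟩
  · rw [← blockAdj_eigs hA hrow hcol hXrow hr'.ne' (by linarith) (by linarith) hac
      (by simpa using hq) h01 (by linarith), ← hG]
    rfl
  · have hX0 : ∃ i j, i ≠ j ∧ X i j = 0 := by
      obtain ⟨i, j, hij, h⟩ := hXoff 1
      exact ⟨i, j, hij, (hX01 i j).resolve_right h⟩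
    have hX1 : ∃ i j, X i j = 1 := by
      obtain ⟨i, j, -, h⟩ := hXoff 0
      exact ⟨i, j, (hX01 i j).resolve_left h⟩
    have hM1' : ∃ i j, M i j = 1 := (hM1 0).imp fun i hi => ⟨0, hi⟩
    have hM0 : ∃ i j, M i j = 0 := by
      by_contra! h
      have hM (i j) : M i j = 1 := (hM01 i j).resolve_left (h i j)
      obtain ⟨i, j, hij⟩ := exists_pair_ne (Fin v)
      have hij' := congrFun (congrFun hMMt i) j
      simp only [Matrix.mul_apply, Matrix.transpose_apply, hM j, mul_one, hrow] at hij'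
      simp [hij] at hij'
      exact hrl0 (sub_eq_zero.mpr (by exact_mod_cast hij'))
    refine hasCoherentRank_nine_of_blockFamily
      (isCoherentConfig_blockFamily hM01 hrow hcol hXsymm hXdiag hX01 hXrow ?_ ?_ ?_ hMX)
      (linearIndependent_blockFamily hM0 hM1' hXdiag hX0 hX1) hne (fun i => ?_)
      (fun j => ?_) G hG
    · rw [hMMt]
      exact Submodule.mem_span_pair.mpr ⟨_, _, rfl⟩
    · rw [hMtM]
      exact Submodule.mem_span_triple.mpr ⟨k - y, x - y, y, by module⟩
    · rw [hXX]
      exact Submodule.mem_span_triple.mpr ⟨-(e1 * e2), e1 + e2, e0 + e1 * e2, by module⟩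
    · simp [hrow, Matrix.one_apply]
    · simp [hcol, hXrow]
end
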